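/- Let (Ω, μ) be a probability space, m ≥ 1, 1 ≤ p < ∞, and for each i = (i_1,…,i_m) ∈ {1,…,n}^m let f_i ∈ L^1(Ω^m). Write Ω̄ = ⨿_{i=1}^n Ω, and for J ⊆ {1,…,m} write J' = {1,…,m} ∖ J. Suppose ∫_{Ω^n} ⋯ ∫_{Ω^n} ( ∑_i |f_i(x^{(1)}_{i_1},…,x^{(m)}_{i_m})|^p )^{1/p} dx^{(1)} ⋯ dx^{(m)} = 1. Then, regarding ⨿_i f_i as a function on Ω̄^m, one has 1 ≤ inf{ ∑_{J ⊆ {1,…,m}} ‖a^{(J)}‖_{L^1(Ω̄^{J'}, L^p(Ω̄^{J}))} : ⨿_i f_i = ∑_{J ⊆ {1,…,m}} a^{(J)} } ≤ C_m, where C_m depends only on m (not on p, n, Ω, or the f_i); moreover a minimizing (up to constant) decomposition with a^{(J)} = ⨿_i a^{(J)}_i can be chosen so that for every i the supports of a^{(J)}_i over different J are pairwise disjoint. -/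

import Mathlib

open MeasureTheory
open scoped ENNReal

universe u

variable {Ω : Type u} [MeasurableSpace Ω]

/-- The mixed norm `‖⨿_i a_i‖_{L¹(Ω̄^{J'}, L^p(Ω̄^{J}))}` on the `m`-fold product of the
disjoint union `Ω̄ = ⨿_{i=1}^n Ω`, where the coordinates indexed by `J' = Jᶜ` form the
outer `L¹` variable and those indexed by `J` form the inner `L^p` variable. -/
noncomputable def mixedNorm (μ : Measure Ω) (p : ℝ) {n m : ℕ} (J : Finset (Fin m))
    (a : (Fin m → Fin n) → (Fin m → Ω) → ℝ) : ℝ≥0∞ :=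
  ∑ i' : {k // k ∉ J} → Fin n,
    ∫⁻ ξ' : {k // k ∉ J} → Ω,
      (∑ i'' : {k // k ∈ J} → Fin n,
        ∫⁻ ξ'' : {k // k ∈ J} → Ω,
          ENNReal.ofReal
            (|a (fun k => if h : k ∈ J then i'' ⟨k, h⟩ else i' ⟨k, h⟩)
                (fun k => if h : k ∈ J then ξ'' ⟨k, h⟩ else ξ' ⟨k, h⟩)| ^ p)
          ∂Measure.pi fun _ => μ) ^ (1/p)
      ∂Measure.pi fun _ => μ

theorem jensen_rpow {α : Type*} [MeasurableSpace α] (ν : Measure α) [IsProbabilityMeasure ν]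
    {F : α → ℝ≥0∞} (hF : Measurable F) {q : ℝ} (hq0 : 0 < q) (hq1 : q ≤ 1) :
    ∫⁻ y, F y ^ q ∂ν ≤ (∫⁻ y, F y ∂ν) ^ q := by
  have h := eLpNorm'_le_eLpNorm'_of_exponent_le (f := F) (μ := ν) hq0 hq1 hF.aestronglyMeasurable
  simp only [eLpNorm', enorm_eq_self, ENNReal.rpow_one, one_div, inv_one] at h
  have h2 := ENNReal.rpow_le_rpow h hq0.le
  rwa [← ENNReal.rpow_mul, inv_mul_cancel₀ hq0.ne', ENNReal.rpow_one] at h2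

theorem sum_rpow_le_aux {ι : Type*} (s : Finset ι) (v : ι → ℝ≥0∞) {q : ℝ} (hq0 : 0 < q)
    (hq1 : q ≤ 1) : (∑ i ∈ s, v i) ^ q ≤ ∑ i ∈ s, v i ^ q := by
  classical
  induction s using Finset.induction_on with
  | empty => simp [hq0]
  | insert a s ha ih =>
    rw [Finset.sum_insert ha, Finset.sum_insert ha]
    exact (ENNReal.rpow_add_le_add_rpow _ _ hq0.le hq1).trans (by gcongr)

theorem lintegral_update {ι Ω : Type*} [Fintype ι] [DecidableEq ι] [MeasurableSpace Ω]
    (μ : Measure Ω) [IsProbabilityMeasure μ]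
    (j : ι) {F : (ι → Ω) → ℝ≥0∞} (hF : Measurable F) :
    ∫⁻ y, F y ∂(Measure.pi fun _ : ι => μ) =
      ∫⁻ t, ∫⁻ y, F (Function.update y j t) ∂(Measure.pi fun _ : ι => μ) ∂μ := by
  rw [lintegral_lintegral_swap]
  swap
  · apply Measurable.aemeasurable
    apply hF.comp
    rw [measurable_pi_iff]
    intro a
    by_cases h : a = j
    · subst h; simp; fun_prop
    · simp [h]; fun_prop
  apply lintegral_eq_of_lmarginal_eq (μ := fun _ : ι => μ) {j} hF
  · apply Measurable.lintegral_prod_right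
    apply hF.comp
    rw [measurable_pi_iff]
    intro a
    by_cases h : a = j
    · subst h; simp; fun_prop
    · simp [h]; fun_prop
  · rw [lmarginal_singleton, lmarginal_singleton]
    simp

theorem lintegral_cons {Ω : Type*} [MeasurableSpace Ω] (μ : Measure Ω) [SigmaFinite μ] (m : ℕ)
    {F : (Fin (m+1) → Ω) → ℝ≥0∞} (hF : Measurable F) :
    ∫⁻ y, F y ∂(Measure.pi fun _ : Fin (m+1) => μ) =
      ∫⁻ t, ∫⁻ y, F (Fin.cons t y) ∂(Measure.pi fun _ : Fin m => μ) ∂μ := by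
  have h := (measurePreserving_piFinSuccAbove (fun _ : Fin (m+1) => μ) 0).symm
  rw [← h.lintegral_comp hF, lintegral_prod]
  · simp [MeasurableEquiv.piFinSuccAbove, Fin.insertNthEquiv]
  · exact (hF.comp (MeasurableEquiv.measurable _)).aemeasurable

theorem sum_cons {m n : ℕ} (F : (Fin (m+1) → Fin n) → ℝ≥0∞) :
    ∑ i, F i = ∑ i0, ∑ i', F (Fin.cons i0 i') := by
  rw [← Fintype.sum_prod_type' (f := fun i0 i' => F (Fin.cons i0 i'))]
  exact (Fintype.sum_equiv (Fin.consEquiv (fun _ => Fin n)) _ _ (fun x => rfl)).symm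

@[fun_prop]
theorem measurable_cons' {Ω α : Type*} [MeasurableSpace Ω] [MeasurableSpace α] {m : ℕ}
    {f : α → Ω} {g : α → Fin m → Ω} (hf : Measurable f) (hg : Measurable g) :
    Measurable (fun a => (Fin.cons (f a) (g a) : Fin (m+1) → Ω)) := by
  rw [measurable_pi_iff]
  intro k
  refine Fin.cases ?_ (fun k => ?_) k
  · simpa using hf
  · simp; fun_prop

theorem measurable_eval' {Ω α : Type*} [MeasurableSpace Ω] [MeasurableSpace α] {n : ℕ}
    {f : α → Fin n → Ω} {j : α → Fin n} (hf : Measurable f) (hj : Measurable j) :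
    Measurable (fun a => f a (j a)) := by
  have : Measurable (fun p : (Fin n → Ω) × Fin n => p.1 p.2) :=
    measurable_from_prod_countable_left (fun k => measurable_pi_apply k)
  exact this.comp (hf.prodMk hj)

theorem measurable_update'' {Ω α : Type*} [MeasurableSpace Ω] [MeasurableSpace α] {n : ℕ}
    {f : α → Fin n → Ω} {j : α → Fin n} {t : α → Ω} (hf : Measurable f) (hj : Measurable j)
    (ht : Measurable t) :
    Measurable (fun a => Function.update (f a) (j a) (t a)) := by
  rw [measurable_pi_iff]
  intro k
  simp only [Function.update_apply]
  refine Measurable.ite ?_ ht (by fun_prop)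
  exact measurableSet_eq_fun measurable_const hj

/-- Pointwise inequality `X ≤ B M^{1-q} X^q + X^2/(BM)`. -/
theorem pointwise_aux {q : ℝ} (hq0 : 0 < q) (hq1 : q ≤ 1) {X M B : ℝ≥0∞} (hM0 : M ≠ 0)
    (hM : M ≠ ∞) (hB1 : 1 ≤ B) (hB : B ≠ ∞) :
    X ≤ B * M ^ (1 - q) * X ^ q + X * X / (B * M) := by
  have hB0 : B ≠ 0 := (zero_lt_one.trans_le hB1).ne'
  rcases le_total X (B * M) with h | h
  · refine le_trans ?_ le_self_add
    rcases eq_or_ne X 0 with rfl | hX0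
    · simp
    have hXt : X ≠ ∞ := ne_top_of_le_ne_top (ENNReal.mul_ne_top hB hM) h
    calc X = X ^ (1 - q) * X ^ q := by
          rw [← ENNReal.rpow_add _ _ hX0 hXt]; simp
      _ ≤ (B * M) ^ (1 - q) * X ^ q := by gcongr
      _ = B ^ (1-q) * M ^ (1 - q) * X ^ q := by
          rw [ENNReal.mul_rpow_of_nonneg _ _ (by linarith)]
      _ ≤ B * M ^ (1 - q) * X ^ q := by
          gcongr
          simpa using ENNReal.rpow_le_rpow_of_exponent_le hB1 (show 1 - q ≤ 1 by linarith)
  · refine le_trans ?_ le_add_self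
    rw [ENNReal.le_div_iff_mul_le (by simp [hB0, hM0]) (by left; exact ENNReal.mul_ne_top hB hM)]
    gcongr

/-- if `r/ ... `: -/
theorem min_rpow_aux {q : ℝ} (hq0 : 0 < q) (hq1 : q ≤ 1) {h r : ℝ≥0∞} (hr : r ≠ ∞) :
    min h r ≤ r ^ (1 - q) * h ^ q := by
  rcases eq_or_ne (min h r) 0 with h0 | h0
  · simp [h0]
  have ht : min h r ≠ ∞ := ne_top_of_le_ne_top hr (min_le_right _ _)
  calc min h r = (min h r) ^ (1 - q) * (min h r) ^ q := by
        rw [← ENNReal.rpow_add _ _ h0 ht]; simp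
    _ ≤ r ^ (1 - q) * h ^ q := by
        gcongr
        · exact min_le_right _ _
        · exact min_le_left _ _

section Key
variable {Ω : Type*} [MeasurableSpace Ω] (μ : Measure Ω) [IsProbabilityMeasure μ]

theorem second_moment {n : ℕ} {g : Fin n → Ω → ℝ≥0∞} (hg : ∀ j, Measurable (g j)) {R : ℝ≥0∞}
    (hR : ∀ j t, g j t ≤ R) :
    ∫⁻ y, (∑ j, g j (y j)) * (∑ j, g j (y j)) ∂(Measure.pi fun _ : Fin n => μ) ≤
      (∑ j, ∫⁻ t, g j t ∂μ) * (R + ∑ j, ∫⁻ t, g j t ∂μ) := by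
  have hev : ∀ j, ∫⁻ y, g j (y j) ∂(Measure.pi fun _ : Fin n => μ) = ∫⁻ t, g j t ∂μ := by
    intro j
    rw [lintegral_update μ j (by fun_prop)]
    simp
  simp only [Finset.sum_mul]
  rw [lintegral_finsetSum _ (by intros; fun_prop)]
  refine Finset.sum_le_sum fun j _ => ?_
  rw [lintegral_update μ j (by fun_prop)]
  simp only [Function.update_self]
  rw [← lintegral_mul_const _ (hg j)]
  gcongr with t
  calc _ ≤ ∫⁻ y, g j t * (R + ∑ l, g l (y l)) ∂(Measure.pi fun _ : Fin n => μ) := by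
        gcongr with y
        rw [← Finset.add_sum_erase _ _ (Finset.mem_univ j), Function.update_self]
        gcongr
        · exact hR j t
        · calc _ = ∑ l ∈ Finset.univ.erase j, g l (y l) := by
                apply Finset.sum_congr rfl
                intro l hl
                rw [Function.update_of_ne (Finset.ne_of_mem_erase hl)]
            _ ≤ _ := Finset.sum_le_sum_of_subset (Finset.erase_subset _ _)
    _ = _ := by
        rw [lintegral_const_mul _ (by fun_prop), lintegral_add_left (by fun_prop),
          lintegral_finsetSum _ (by intros; fun_prop)]
        simp [hev]

variable {n : ℕ} {G : Fin n → Ω → ℝ≥0∞} {H : Fin n → (Fin n → Ω) → ℝ≥0∞} {q : ℝ} {k : ℝ≥0∞}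

theorem key1 (hG : ∀ j, Measurable (G j)) (hH : ∀ j, Measurable (H j))
    (hHG : ∀ j y, H j y ≤ G j (y j)) (hq0 : 0 < q) (hq1 : q ≤ 1) (hk1 : 1 ≤ k) (hk : k ≠ ∞)
    (hQ : ∀ j t R, R ≠ ∞ → min (G j t) R ≤
      k * ∫⁻ y, min (H j (Function.update y j t)) R ∂(Measure.pi fun _ : Fin n => μ))
    {R : ℝ≥0∞} (hR : R ≠ ∞) (hM : R < 4 * k * ∑ j, ∫⁻ t, min (G j t) R ∂μ) :
    (∑ j, ∫⁻ t, min (G j t) R ∂μ) ^ q ≤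
      20 * k ^ 3 * ∫⁻ y, (∑ j, H j y) ^ q ∂(Measure.pi fun _ : Fin n => μ) := by
  set M := ∑ j, ∫⁻ t, min (G j t) R ∂μ with hMdef
  set T := ∫⁻ y, (∑ j, H j y) ^ q ∂(Measure.pi fun _ : Fin n => μ) with hT
  have hM0 : M ≠ 0 := by
    rintro h; rw [h] at hM; simp at hM
  have hMt : M ≠ ∞ := by
    rw [hMdef]
    refine ENNReal.sum_ne_top.2 fun j _ => ?_
    refine ne_top_of_le_ne_top hR ?_
    calc _ ≤ ∫⁻ t, R ∂μ := by gcongr; exact min_le_right _ _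
      _ = R := by simp
  have hk0 : k ≠ 0 := (zero_lt_one.trans_le hk1).ne'
  set X : (Fin n → Ω) → ℝ≥0∞ := fun y => ∑ j, min (H j y) R with hX
  have hXm : Measurable X := by fun_prop
  have h1 : M ≤ k * ∫⁻ y, X y ∂(Measure.pi fun _ : Fin n => μ) := by
    rw [hX, lintegral_finsetSum _ (by intros; fun_prop), Finset.mul_sum, hMdef]
    refine Finset.sum_le_sum fun j _ => ?_
    rw [lintegral_update μ j (by fun_prop), ← lintegral_const_mul' _ _ hk]
    gcongr with t
    exact hQ j t R hR
  have h2 : ∫⁻ y, X y * X y ∂(Measure.pi fun _ : Fin n => μ) ≤ 5 * k * M * M := by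
    calc _ ≤ ∫⁻ y, (∑ j, min (G j (y j)) R) * (∑ j, min (G j (y j)) R)
          ∂(Measure.pi fun _ : Fin n => μ) := by
          simp only [hX]
          gcongr <;> exact hHG _ _
      _ ≤ M * (R + M) := second_moment μ (g := fun j t => min (G j t) R)
          (fun j => (hG j).min measurable_const) (fun j t => min_le_right _ _)
      _ ≤ M * (4 * k * M + k * M) := by
          gcongr
          exact le_mul_of_one_le_left (zero_le) hk1
      _ = 5 * k * M * M := by ring
  have h3 : ∫⁻ y, X y ∂(Measure.pi fun _ : Fin n => μ) ≤
      (10 * k^2) * M ^ (1 - q) * T + (5 * k * M * M) / ((10 * k^2) * M) := by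
    have hB : (10 * k^2 : ℝ≥0∞) ≠ ∞ := by finiteness
    have hB1 : 1 ≤ 10 * k^2 := by
      calc (1:ℝ≥0∞) = 1 * 1 := by simp
        _ ≤ 10 * k^2 := by
          gcongr
          · norm_num
          · exact one_le_pow₀ hk1
    calc _ ≤ ∫⁻ y, ((10 * k^2) * M ^ (1 - q) * (X y) ^ q + X y * X y / ((10 * k^2) * M))
          ∂(Measure.pi fun _ : Fin n => μ) := by
          gcongr with y
          exact pointwise_aux hq0 hq1 hM0 hMt hB1 hB
      _ = (10 * k^2) * M ^ (1 - q) * ∫⁻ y, (X y) ^ q ∂(Measure.pi fun _ : Fin n => μ)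
          + (∫⁻ y, X y * X y ∂(Measure.pi fun _ : Fin n => μ)) / ((10 * k^2) * M) := by
          rw [lintegral_add_left (by fun_prop), lintegral_const_mul _ (by fun_prop)]
          simp_rw [div_eq_mul_inv]
          rw [lintegral_mul_const _ (by fun_prop)]
      _ ≤ _ := by
          gcongr
          rw [hT, hX]
          gcongr with y
          exact Finset.sum_le_sum fun j _ => min_le_left _ _
  have h4 : k * ((5 * k * M * M) / ((10 * k^2) * M)) = M / 2 := by
    rw [← mul_div_assoc]
    rw [show k * (5 * k * M * M) = M * (5 * k ^ 2 * M) by ring,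
      show 10 * k^2 * M = 2 * (5 * k^2 * M) by ring]
    rw [ENNReal.mul_div_mul_right]
    · simp [hk0, hM0]
    · finiteness
  have h5 : M ≤ k * ((10 * k^2) * M ^ (1 - q) * T) + M / 2 := by
    calc M ≤ k * ((10 * k^2) * M ^ (1 - q) * T + (5 * k * M * M) / ((10 * k^2) * M)) := by
          refine h1.trans ?_; gcongr
      _ = _ := by rw [mul_add, h4]
  have h6 : M / 2 ≤ k * ((10 * k^2) * M ^ (1 - q) * T) := by
    have hh : M / 2 + M / 2 ≤ k * ((10 * k^2) * M ^ (1 - q) * T) + M / 2 := by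
      rwa [ENNReal.add_halves]
    exact (ENNReal.add_le_add_iff_right (by finiteness)).1 hh
  have h7 : M ≤ 20 * k^3 * T * M ^ (1-q) := by
    rw [ENNReal.div_le_iff (by simp) (by simp)] at h6
    refine h6.trans (le_of_eq (by ring))
  have h8 : M ^ q * M ^ (1 - q) ≤ 20 * k^3 * T * M ^ (1-q) := by
    rw [← ENNReal.rpow_add _ _ hM0 hMt]; simpa using h7
  refine (ENNReal.mul_le_mul_iff_left ?_ ?_).1 h8
  · simp [ENNReal.rpow_eq_zero_iff, hM0, hMt]
  · exact ENNReal.rpow_ne_top_of_nonneg (by linarith) hMt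

theorem key2_aux (hH : ∀ j, Measurable (H j))
    (hG : ∀ j, Measurable (G j))
    (hq0 : 0 < q) (hq1 : q ≤ 1) (hk : k ≠ ∞)
    (hQ : ∀ j t R, R ≠ ∞ → min (G j t) R ≤
      k * ∫⁻ y, min (H j (Function.update y j t)) R ∂(Measure.pi fun _ : Fin n => μ))
    {R : ℝ≥0∞} (hS : 2 * k * ∑ j, μ {t | R < G j t} ≤ 1) (j : Fin n) (t : Ω) :
    (G j t) ^ q ≤ 2 * k * ∫⁻ y, {y : Fin n → Ω | ∀ l, l ≠ j → G l (y l) ≤ R}.indicator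
      (fun y => H j (Function.update y j t) ^ q) y ∂(Measure.pi fun _ : Fin n => μ) := by
  set N := {y : Fin n → Ω | ∀ l, l ≠ j → G l (y l) ≤ R} with hN
  have hNm : MeasurableSet N := by
    rw [hN]
    simp only [Set.ofPred_forall]
    refine MeasurableSet.iInter fun l => MeasurableSet.iInter fun _ => ?_
    exact measurableSet_le (by fun_prop) measurable_const
  set I := ∫⁻ y, N.indicator
      (fun y => H j (Function.update y j t) ^ q) y ∂(Measure.pi fun _ : Fin n => μ) with hI
  have hupd : Measurable (fun y : Fin n → Ω => Function.update y j t) := by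
    fun_prop
  have hHu : Measurable (fun y : Fin n → Ω => H j (Function.update y j t)) := (hH j).comp hupd
  have hSS : ∑ l, ∫⁻ y, ({t | R < G l t}.indicator 1 (y l) : ℝ≥0∞)
      ∂(Measure.pi fun _ : Fin n => μ) = ∑ j, μ {t | R < G j t} := by
    refine Finset.sum_congr rfl fun l _ => ?_
    have hms : MeasurableSet {t | R < G l t} := measurableSet_lt measurable_const (hG l)
    have hmi : Measurable ({t | R < G l t}.indicator (1 : Ω → ℝ≥0∞)) :=
      measurable_one.indicator hms
    rw [lintegral_update μ l (by fun_prop)]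
    simp [lintegral_indicator_one hms]
  have main : ∀ r : ℝ≥0∞, r ≠ ∞ → r ≤ G j t → r ^ q ≤ 2 * k * I := by
    intro r hr hrG
    rcases eq_or_ne r 0 with rfl | hr0
    · simp [hq0]
    have h1 : r ≤ k * (r ^ (1 - q) * I + r * ∑ j, μ {t | R < G j t}) := by
      calc r = min (G j t) r := by rw [min_eq_right hrG]
        _ ≤ _ := hQ j t r hr
        _ ≤ k * ∫⁻ y, (r ^ (1 - q) * N.indicator (fun y => H j (Function.update y j t) ^ q) y
              + r * ∑ l, {t | R < G l t}.indicator 1 (y l)) ∂(Measure.pi fun _ : Fin n => μ) := by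
            gcongr with y
            by_cases hy : y ∈ N
            · refine le_trans ?_ le_self_add
              rw [Set.indicator_of_mem hy]
              exact min_rpow_aux hq0 hq1 hr
            · refine le_trans ?_ le_add_self
              simp only [hN, Set.mem_ofPred_eq, not_forall, not_le] at hy
              obtain ⟨l, hl, hlR⟩ := hy
              have : (1 : ℝ≥0∞) ≤ ∑ l, {t | R < G l t}.indicator 1 (y l) := by
                refine le_trans ?_ (Finset.single_le_sum (fun _ _ => zero_le) (Finset.mem_univ l))
                simp [hlR]
              calc _ ≤ r * 1 := by simp
                _ ≤ _ := by gcongr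
        _ = _ := by
            have hmi : ∀ l, Measurable ({t | R < G l t}.indicator (1 : Ω → ℝ≥0∞)) := fun l =>
              measurable_one.indicator (measurableSet_lt measurable_const (hG l))
            have hm1 : Measurable (N.indicator (fun y => H j (Function.update y j t) ^ q)) :=
              (hHu.pow_const q).indicator hNm
            rw [lintegral_add_left (hm1.const_mul _), lintegral_const_mul _ hm1,
              lintegral_const_mul _ (by fun_prop), lintegral_finsetSum _ (by intros; fun_prop), hSS]
    have h2 : r + r ≤ 2 * k * I * r ^ (1 - q) + r := by
      calc r + r = 2 * r := by ring
        _ ≤ 2 * (k * (r ^ (1 - q) * I + r * ∑ j, μ {t | R < G j t})) := by gcongr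
        _ = 2 * k * I * r ^ (1 - q) + r * (2 * k * ∑ j, μ {t | R < G j t}) := by ring
        _ ≤ 2 * k * I * r ^ (1 - q) + r * 1 := by gcongr
        _ = _ := by simp
    have h3 : r ≤ 2 * k * I * r ^ (1 - q) := (ENNReal.add_le_add_iff_right hr).1 h2
    have h8 : r ^ q * r ^ (1 - q) ≤ 2 * k * I * r ^ (1-q) := by
      rw [← ENNReal.rpow_add _ _ hr0 hr]; simpa using h3
    refine (ENNReal.mul_le_mul_iff_left ?_ ?_).1 h8
    · simp [ENNReal.rpow_eq_zero_iff, hr0, hr]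
    · exact ENNReal.rpow_ne_top_of_nonneg (by linarith) hr
  refine le_of_forall_lt fun x hx => ?_
  obtain ⟨x', hx', hx''⟩ := exists_between hx
  refine lt_of_lt_of_le hx' ?_
  have h := main (x' ^ (1/q)) (ENNReal.rpow_ne_top_of_nonneg (by positivity) hx''.ne_top) ?_
  · rwa [← ENNReal.rpow_mul, one_div, inv_mul_cancel₀ hq0.ne', ENNReal.rpow_one] at h
  · rw [one_div, ENNReal.rpow_inv_le_iff hq0]
    exact hx''.le

theorem key2 (hG : ∀ j, Measurable (G j)) (hH : ∀ j, Measurable (H j))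
    (hq0 : 0 < q) (hq1 : q ≤ 1) (hk : k ≠ ∞)
    (hQ : ∀ j t R, R ≠ ∞ → min (G j t) R ≤
      k * ∫⁻ y, min (H j (Function.update y j t)) R ∂(Measure.pi fun _ : Fin n => μ))
    {R : ℝ≥0∞} (hS : 2 * k * ∑ j, μ {t | R < G j t} ≤ 1) :
    ∑ j, ∫⁻ t, {t | R < G j t}.indicator (fun t => G j t ^ q) t ∂μ ≤
      2 * k * ∫⁻ y, (∑ j, H j y) ^ q ∂(Measure.pi fun _ : Fin n => μ) := by
  classical
  set E : Fin n → Set (Fin n → Ω) := fun j =>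
    {y | R < G j (y j) ∧ ∀ l, l ≠ j → G l (y l) ≤ R} with hE
  have hEm : ∀ j, MeasurableSet (E j) := by
    intro j
    have h1 : E j = {y : Fin n → Ω | R < G j (y j)} ∩
        {y : Fin n → Ω | ∀ l, l ≠ j → G l (y l) ≤ R} := rfl
    rw [h1]
    refine MeasurableSet.inter
      (measurableSet_lt measurable_const ((hG j).comp (measurable_pi_apply j))) ?_
    simp only [Set.ofPred_forall]
    refine MeasurableSet.iInter fun l => MeasurableSet.iInter fun _ => ?_
    exact measurableSet_le (by fun_prop) measurable_const
  have hm : ∀ j, Measurable ((E j).indicator (fun y => H j y ^ q)) := fun j =>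
    ((hH j).pow_const q).indicator (hEm j)
  calc _ ≤ ∑ j, 2 * k * ∫⁻ y, (E j).indicator (fun y => H j y ^ q) y
          ∂(Measure.pi fun _ : Fin n => μ) := by
        refine Finset.sum_le_sum fun j _ => ?_
        rw [lintegral_update μ j (hm j), ← lintegral_const_mul' _ _ (by finiteness)]
        gcongr with t
        by_cases ht : R < G j t
        · rw [Set.indicator_of_mem (by exact ht)]
          refine (key2_aux μ hH hG hq0 hq1 hk hQ hS j t).trans ?_
          gcongr with y
          by_cases hy : y ∈ {y : Fin n → Ω | ∀ l, l ≠ j → G l (y l) ≤ R}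
          · rw [Set.indicator_of_mem hy, Set.indicator_of_mem]
            refine ⟨by simpa using ht, fun l hl => ?_⟩
            rw [Function.update_of_ne hl]
            exact hy l hl
          · rw [Set.indicator_of_notMem hy]
            exact zero_le
        · rw [Set.indicator_of_notMem (by exact ht)]
          exact zero_le
    _ = 2 * k * ∫⁻ y, ∑ j, (E j).indicator (fun y => H j y ^ q) y
          ∂(Measure.pi fun _ : Fin n => μ) := by
        rw [lintegral_finsetSum _ (fun j _ => hm j), Finset.mul_sum]
    _ ≤ _ := by
        gcongr with y
        by_cases h : ∃ j, y ∈ E j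
        · obtain ⟨j, hj⟩ := h
          rw [Finset.sum_eq_single j]
          · rw [Set.indicator_of_mem hj]
            gcongr
            exact Finset.single_le_sum (f := fun j => H j y) (fun _ _ => zero_le) (Finset.mem_univ j)
          · intro l _ hl
            refine Set.indicator_of_notMem (fun hyl => ?_) _
            exact absurd hyl.1 (not_lt.2 (hj.2 l hl))
          · simp
        · push Not at h
          rw [Finset.sum_eq_zero]
          · exact zero_le
          · intro j _
            exact Set.indicator_of_notMem (h j) _

/-- The threshold. -/
noncomputable def thr (k : ℝ≥0∞) (q : ℝ) (T : ℝ≥0∞) : ℝ≥0∞ := (80 * k ^ 4 * T) ^ (1 / q)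

theorem key (hG : ∀ j, Measurable (G j)) (hH : ∀ j, Measurable (H j))
    (hHG : ∀ j y, H j y ≤ G j (y j)) (hq0 : 0 < q) (hq1 : q ≤ 1) (hk1 : 1 ≤ k) (hk : k ≠ ∞)
    (hQ : ∀ j t R, R ≠ ∞ → min (G j t) R ≤
      k * ∫⁻ y, min (H j (Function.update y j t)) R ∂(Measure.pi fun _ : Fin n => μ))
    {T : ℝ≥0∞} (hT : T = ∫⁻ y, (∑ j, H j y) ^ q ∂(Measure.pi fun _ : Fin n => μ)) :
    (∑ j, ∫⁻ t, {t | thr k q T < G j t}.indicator (fun t => G j t ^ q) t ∂μ ≤ 80 * k ^ 4 * T) ∧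
    ((∑ j, ∫⁻ t, {t | thr k q T < G j t}ᶜ.indicator (fun t => G j t) t ∂μ) ^ q
      ≤ 80 * k ^ 4 * T) := by
  have hk0 : k ≠ 0 := (zero_lt_one.trans_le hk1).ne'
  have hc0 : 80 * k ^ 4 ≠ 0 := by simp [hk0]
  have hqi : 0 < 1 / q := by positivity
  rcases eq_or_ne T 0 with hT0 | hT0
  · -- everything vanishes
    have hG0 : ∀ j, ∀ᵐ t ∂μ, G j t = 0 := by
      intro j
      rw [hT0, eq_comm, lintegral_eq_zero_iff (by fun_prop)] at hT
      have h1 : ∫⁻ y, min (H j y) 1 ∂(Measure.pi fun _ : Fin n => μ) = 0 := by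
        rw [lintegral_eq_zero_iff (by fun_prop)]
        filter_upwards [hT] with y hy
        simp only [Pi.zero_apply, ENNReal.rpow_eq_zero_iff, hq0, and_true, hq0.not_gt, and_false,
          or_false, Finset.sum_eq_zero_iff] at hy
        simp [hy j (Finset.mem_univ j)]
      have h2 : ∫⁻ t, min (G j t) 1 ∂μ = 0 := by
        refine le_antisymm ?_ zero_le
        calc _ ≤ ∫⁻ t, k * ∫⁻ y, min (H j (Function.update y j t)) 1
                ∂(Measure.pi fun _ : Fin n => μ) ∂μ := by
              gcongr with t
              exact hQ j t 1 (by simp)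
          _ = 0 := by
              rw [lintegral_const_mul' _ _ hk, ← lintegral_update μ j (F := fun y => min (H j y) 1)
                (by fun_prop), h1, mul_zero]
      rw [lintegral_eq_zero_iff (by fun_prop)] at h2
      filter_upwards [h2] with t ht
      simpa using ht
    constructor
    · refine le_of_eq_of_le ?_ zero_le
      refine Finset.sum_eq_zero fun j _ => ?_
      rw [← lintegral_zero (μ := μ)]
      refine lintegral_congr_ae ?_
      filter_upwards [hG0 j] with t ht
      simp [ht]
    · refine le_of_eq_of_le ?_ zero_le
      rw [Finset.sum_eq_zero, ENNReal.zero_rpow_of_pos hq0]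
      intro j _
      rw [← lintegral_zero (μ := μ)]
      refine lintegral_congr_ae ?_
      filter_upwards [hG0 j] with t ht
      simp [ht]
  rcases eq_or_ne T ∞ with hTt | hTt
  · have : 80 * k ^ 4 * T = ∞ := by rw [hTt, ENNReal.mul_top hc0]
    rw [this]
    simp
  set R := thr k q T with hR
  have hRq : R ^ q = 80 * k ^ 4 * T := by
    rw [hR, thr, ← ENNReal.rpow_mul, one_div, inv_mul_cancel₀ hq0.ne', ENNReal.rpow_one]
  have hRt : R ≠ ∞ := by
    rw [hR, thr]; exact ENNReal.rpow_ne_top_of_nonneg hqi.le (by finiteness)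
  have hR0 : R ≠ 0 := by
    intro h
    rw [h, ENNReal.zero_rpow_of_pos hq0] at hRq
    simp [hk0, hT0] at hRq
  have hM : 4 * k * ∑ j, ∫⁻ t, min (G j t) R ∂μ ≤ R := by
    by_contra! hcon
    have h1 := key1 μ hG hH hHG hq0 hq1 hk1 hk hQ hRt hcon
    rw [← hT] at h1
    have h2 := ENNReal.rpow_lt_rpow hcon hq0
    rw [hRq, ENNReal.mul_rpow_of_nonneg _ _ hq0.le] at h2
    refine absurd h2 (not_lt.2 ?_)
    calc _ ≤ (4 * k) * (20 * k ^ 3 * T) := by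
          gcongr
          have : 1 ≤ 4 * k := by
            calc (1:ℝ≥0∞) = 1 * 1 := by simp
              _ ≤ _ := by gcongr; norm_num
          simpa using ENNReal.rpow_le_rpow_of_exponent_le this hq1
      _ = _ := by ring
  have hS : 2 * k * ∑ j, μ {t | R < G j t} ≤ 1 := by
    have h1 : R * ∑ j, μ {t | R < G j t} ≤ ∑ j, ∫⁻ t, min (G j t) R ∂μ := by
      rw [Finset.mul_sum]
      refine Finset.sum_le_sum fun j _ => ?_
      calc R * μ {t | R < G j t} ≤ R * μ {t | R ≤ min (G j t) R} := by
            gcongr with t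
            intro ht
            simpa using ht.le
        _ ≤ _ := mul_meas_ge_le_lintegral (by fun_prop) _
    have h2 : R * (2 * k * ∑ j, μ {t | R < G j t}) ≤ R * 1 := by
      calc _ = 2 * k * (R * ∑ j, μ {t | R < G j t}) := by ring
        _ ≤ 4 * k * ∑ j, ∫⁻ t, min (G j t) R ∂μ := by gcongr; norm_num
        _ ≤ R * 1 := by simpa using hM
    exact (ENNReal.mul_le_mul_iff_right hR0 hRt).1 h2
  constructor
  · refine (key2 μ hG hH hq0 hq1 hk hQ hS).trans ?_
    rw [← hT]
    gcongr
    · norm_num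
    · exact le_self_pow₀ hk1 (by norm_num)
  · rw [← hRq]
    gcongr
    calc _ ≤ ∑ j, ∫⁻ t, min (G j t) R ∂μ := by
          refine Finset.sum_le_sum fun j _ => lintegral_mono fun t => ?_
          by_cases ht : R < G j t
          · rw [Set.indicator_of_notMem (by simpa using ht)]; exact zero_le
          · rw [Set.indicator_of_mem (by simpa using ht)]
            simp at ht
            simp [ht]
      _ ≤ 4 * k * ∑ j, ∫⁻ t, min (G j t) R ∂μ := by
          refine le_mul_of_one_le_left zero_le ?_
          calc (1:ℝ≥0∞) = 1 * 1 := by simp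
              _ ≤ _ := by gcongr; norm_num
      _ ≤ R := hM

end Key

section L1
variable {Ω : Type*} [MeasurableSpace Ω] (μ : Measure Ω) [IsProbabilityMeasure μ]

theorem min_weight {α : Type*} [MeasurableSpace α] (P : Measure α) [IsProbabilityMeasure P]
    {Λ : Type*} [MeasurableSpace Λ] (lam : Measure Λ) [SigmaFinite lam]
    {g : Λ → ℝ≥0∞} (hgt : ∀ l, g l ≠ ∞) {b : Λ × α → ℝ≥0∞}
    (hb : Measurable b) (hb1 : ∀ w, b w ≤ 1) {k : ℝ≥0∞} (hk : k ≠ ∞)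
    (hyp : ∀ l, g l ≠ 0 → 1 ≤ k * ∫⁻ y, b (l, y) ∂P) {R : ℝ≥0∞} :
    min (∫⁻ l, g l ∂lam) R ≤ k * ∫⁻ y, min (∫⁻ l, g l * b (l, y) ∂lam) R ∂P := by
  refine le_of_forall_lt fun L hL => ?_
  rw [lt_min_iff] at hL
  have hgg : ∀ l, ((g l).toNNReal : ℝ≥0∞) = g l := fun l => ENNReal.coe_toNNReal (hgt l)
  have hL1 : L < ∫⁻ l, ((g l).toNNReal : ℝ≥0∞) ∂lam := by simpa only [hgg] using hL.1
  obtain ⟨g', hg', hfin, hL'⟩ := exists_lt_lintegral_simpleFunc_of_lt_lintegral hL1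
  set G' := ∫⁻ l, (g' l : ℝ≥0∞) ∂lam with hG'
  have hle : ∀ l, (g' l : ℝ≥0∞) ≤ g l := fun l => by
    rw [← hgg l]; exact_mod_cast hg' l
  have hg'm : Measurable (fun l => (g' l : ℝ≥0∞)) := g'.measurable.coe_nnreal_ennreal
  refine lt_of_lt_of_le (lt_min hL' hL.2) ?_
  rcases eq_or_ne G' 0 with h0 | h0
  · simp [h0]
  set H' : α → ℝ≥0∞ := fun y => ∫⁻ l, (g' l : ℝ≥0∞) * b (l, y) ∂lam with hH'
  have hm2 : Measurable (fun w : α × Λ => (g' w.2 : ℝ≥0∞) * b (w.2, w.1)) := by fun_prop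
  have hH'm : Measurable H' := hm2.lintegral_prod_right'
  have hHG : ∀ y, H' y ≤ G' := fun y => by
    refine lintegral_mono fun l => ?_
    exact mul_le_of_le_one_right zero_le (hb1 _)
  have h1 : G' ≤ k * ∫⁻ y, H' y ∂P := by
    rw [hH', lintegral_lintegral_swap hm2.aemeasurable, ← lintegral_const_mul' _ _ hk]
    refine lintegral_mono fun l => ?_
    dsimp only
    rw [lintegral_const_mul _ (by fun_prop)]
    rcases eq_or_ne (g' l : ℝ≥0∞) 0 with hz | hz
    · simp [hz]
    have := hyp l (fun h => hz (le_antisymm (h ▸ hle l) zero_le))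
    calc (g' l : ℝ≥0∞) = g' l * 1 := by simp
      _ ≤ g' l * (k * ∫⁻ y, b (l, y) ∂P) := by gcongr
      _ = _ := by ring
  have h2 : ∀ y, H' y * min G' R ≤ G' * min (H' y) R := by
    intro y
    rcases le_total (H' y) R with h | h
    · rw [min_eq_left h, mul_comm]
      gcongr
      exact min_le_left _ _
    · rw [min_eq_right h]
      gcongr
      · exact hHG y
      · exact min_le_right _ _
  have h3 : G' * min G' R ≤ G' * (k * ∫⁻ y, min (H' y) R ∂P) := by
    calc G' * min G' R ≤ (k * ∫⁻ y, H' y ∂P) * min G' R := by gcongr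
      _ = k * ∫⁻ y, H' y * min G' R ∂P := by
          rw [lintegral_mul_const _ hH'm]; ring
      _ ≤ k * ∫⁻ y, G' * min (H' y) R ∂P := by
          exact mul_le_mul_right (lintegral_mono h2) k
      _ = _ := by
          rw [lintegral_const_mul _ (by fun_prop)]; ring
  refine ((ENNReal.mul_le_mul_iff_right h0 hfin.ne).1 h3).trans ?_
  refine mul_le_mul_right (lintegral_mono fun y => min_le_min_right _ ?_) k
  exact lintegral_mono fun l => mul_le_mul_left (hle l) _

theorem L1 {n : ℕ} {Λ : Type*} [MeasurableSpace Λ] (lam : Measure Λ) [SigmaFinite lam]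
    {i : Λ → Fin n} (hi : Measurable i) {g : Λ × Ω → ℝ≥0∞} (hg : Measurable g)
    (hgt : ∀ w, g w ≠ ∞) {b : Λ × (Fin n → Ω) → ℝ≥0∞} (hb : Measurable b) (hb1 : ∀ w, b w ≤ 1)
    {q : ℝ} (hq0 : 0 < q) (hq1 : q ≤ 1) {k : ℝ≥0∞} (hk1 : 1 ≤ k) (hk : k ≠ ∞)
    (hyp : ∀ l t, g (l, t) ≠ 0 →
      1 ≤ k * ∫⁻ y, b (l, Function.update y (i l) t) ∂(Measure.pi fun _ : Fin n => μ)) :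
    ∫⁻ y, (∫⁻ l, g (l, y (i l)) ∂lam) ^ q ∂(Measure.pi fun _ : Fin n => μ) ≤
      160 * k ^ 4 * ∫⁻ y, (∫⁻ l, g (l, y (i l)) * b (l, y) ∂lam) ^ q
        ∂(Measure.pi fun _ : Fin n => μ) := by
  classical
  set G : Fin n → Ω → ℝ≥0∞ := fun j t => ∫⁻ l, (if i l = j then g (l, t) else 0) ∂lam with hGdef
  set H : Fin n → (Fin n → Ω) → ℝ≥0∞ := fun j y =>
    ∫⁻ l, (if i l = j then g (l, y j) else 0) * b (l, y) ∂lam with hHdef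
  have hgm : ∀ j, Measurable (fun w : Ω × Λ => if i w.2 = j then g (w.2, w.1) else 0) := fun j =>
    Measurable.ite (measurableSet_eq_fun (hi.comp measurable_snd) measurable_const)
      (by fun_prop) measurable_const
  have hGm : ∀ j, Measurable (G j) := fun j => (hgm j).lintegral_prod_right'
  have hgm2 : ∀ j, Measurable (fun w : (Fin n → Ω) × Λ =>
      (if i w.2 = j then g (w.2, w.1 j) else 0) * b (w.2, w.1)) := fun j =>
    (Measurable.ite (measurableSet_eq_fun (hi.comp measurable_snd) measurable_const)
      (by fun_prop) measurable_const).mul (by fun_prop)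
  have hHm : ∀ j, Measurable (H j) := fun j => (hgm2 j).lintegral_prod_right'
  have hHG : ∀ j y, H j y ≤ G j (y j) := fun j y =>
    lintegral_mono fun l => mul_le_of_le_one_right zero_le (hb1 _)
  have hGs : ∀ y : Fin n → Ω, ∑ j, G j (y j) = ∫⁻ l, g (l, y (i l)) ∂lam := by
    intro y
    simp only [hGdef]
    rw [← lintegral_finsetSum _ (fun j _ => by
      exact (hgm j).comp (measurable_prodMk_left (x := y j)))]
    simp
  have hHs : ∀ y : Fin n → Ω, ∑ j, H j y = ∫⁻ l, g (l, y (i l)) * b (l, y) ∂lam := by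
    intro y
    simp only [hHdef]
    rw [← lintegral_finsetSum _ (fun j _ => by
      exact (hgm2 j).comp (measurable_prodMk_left (x := y)))]
    simp
  have hQ : ∀ j t R, R ≠ ∞ → min (G j t) R ≤
      k * ∫⁻ y, min (H j (Function.update y j t)) R ∂(Measure.pi fun _ : Fin n => μ) := by
    intro j t R hR
    have := min_weight (Measure.pi fun _ : Fin n => μ) lam
      (g := fun l => if i l = j then g (l, t) else 0)
      (b := fun w => b (w.1, Function.update w.2 j t)) (k := k) (R := R) ?_ ?_ ?_ hk ?_
    · simpa [hGdef, hHdef] using this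
    · intro l; split_ifs
      · exact hgt _
      · simp
    · exact hb.comp (measurable_fst.prodMk (measurable_update'' measurable_snd measurable_const
        measurable_const))
    · intro w; exact hb1 _
    · intro l hl
      have hij : i l = j := by by_contra h; simp [h] at hl
      rw [← hij]
      apply hyp
      simpa [hij] using hl
  obtain ⟨h1, h2⟩ := key μ hGm hHm hHG hq0 hq1 hk1 hk hQ rfl
  simp only [hHs] at h1 h2
  simp only [← hGs]
  set T := ∫⁻ y, (∫⁻ l, g (l, y (i l)) * b (l, y) ∂lam) ^ q ∂(Measure.pi fun _ : Fin n => μ)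
  set R := thr k q T
  have hms : ∀ j, MeasurableSet {t | R < G j t} := fun j =>
    measurableSet_lt measurable_const (hGm j)
  have hm1 : ∀ j, Measurable ({t | R < G j t}.indicator (fun t => G j t ^ q)) := fun j =>
    ((hGm j).pow_const q).indicator (hms j)
  have hm2 : ∀ j, Measurable ({t | R < G j t}ᶜ.indicator (fun t => G j t)) := fun j =>
    (hGm j).indicator (hms j).compl
  have hev : ∀ (j : Fin n) (F : Ω → ℝ≥0∞), Measurable F →
      ∫⁻ y, F (y j) ∂(Measure.pi fun _ : Fin n => μ) = ∫⁻ t, F t ∂μ := by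
    intro j F hF
    rw [lintegral_update μ j (by fun_prop)]
    simp
  calc _ ≤ ∫⁻ y, (∑ j, {t | R < G j t}.indicator (fun t => G j t ^ q) (y j) +
        (∑ j, {t | R < G j t}ᶜ.indicator (fun t => G j t) (y j)) ^ q)
          ∂(Measure.pi fun _ : Fin n => μ) := by
        refine lintegral_mono fun y => ?_
        have : ∑ j, G j (y j) = ∑ j, {t | R < G j t}.indicator (fun t => G j t) (y j) +
            ∑ j, {t | R < G j t}ᶜ.indicator (fun t => G j t) (y j) := by
          rw [← Finset.sum_add_distrib]
          exact Finset.sum_congr rfl fun j _ => (Set.indicator_self_add_compl_apply _ _ _).symm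
        dsimp only
        rw [this]
        refine (ENNReal.rpow_add_le_add_rpow _ _ hq0.le hq1).trans ?_
        gcongr
        refine (sum_rpow_le_aux _ _ hq0 hq1).trans ?_
        refine Finset.sum_le_sum fun j _ => ?_
        by_cases h : R < G j (y j)
        · simp [h]
        · simp [h, hq0]
    _ = ∑ j, ∫⁻ t, {t | R < G j t}.indicator (fun t => G j t ^ q) t ∂μ +
        ∫⁻ y, (∑ j, {t | R < G j t}ᶜ.indicator (fun t => G j t) (y j)) ^ q
          ∂(Measure.pi fun _ : Fin n => μ) := by
        rw [lintegral_add_left (by fun_prop), lintegral_finsetSum _ (by intros; fun_prop)]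
        congr 1
        exact Finset.sum_congr rfl fun j _ => hev j _ (hm1 j)
    _ ≤ 80 * k ^ 4 * T + 80 * k ^ 4 * T := by
        gcongr
        refine (jensen_rpow _ (by fun_prop) hq0 hq1).trans ?_
        rw [lintegral_finsetSum _ (by intros; fun_prop)]
        refine le_of_eq_of_le ?_ h2
        congr 1
        exact Finset.sum_congr rfl fun j _ => hev j _ (hm2 j)
    _ = _ := by ring

end L1

/-- The constants of the multidimensional comparison lemma. -/
noncomputable def CL : ℕ → ℝ≥0∞ → ℝ≥0∞
  | 0, k => k
  | m + 1, k => 160 * (2 * k) ^ 4 * CL m (2 * k)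

theorem CL_ne_top (m : ℕ) : ∀ k : ℝ≥0∞, k ≠ ∞ → CL m k ≠ ∞ := by
  induction m with
  | zero => intro k hk; exact hk
  | succ m ih =>
    intro k hk
    have := ih (2 * k) (by finiteness)
    rw [CL]
    finiteness

section Lm
variable {Ω : Type*} [MeasurableSpace Ω] (μ : Measure Ω) [IsProbabilityMeasure μ]

theorem Lm {n : ℕ} {Λ : Type*} [MeasurableSpace Λ] (lam : Measure Λ) [SigmaFinite lam]
    {q : ℝ} (hq0 : 0 < q) (hq1 : q ≤ 1) (m : ℕ) : ∀ {k : ℝ≥0∞} (_ : 1 ≤ k) (_ : k ≠ ∞)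
    {i : Λ → Fin m → Fin n} (_ : Measurable i) {g : Λ × (Fin m → Ω) → ℝ≥0∞} (_ : Measurable g)
    (_ : ∀ w, g w ≠ ∞) {b : Λ × (Fin m → Fin n → Ω) → ℝ≥0∞} (_ : Measurable b)
    (_ : ∀ w, b w ≤ 1)
    (_ : ∀ l ξ, g (l, ξ) ≠ 0 →
      1 ≤ k * ∫⁻ x : Fin m → Fin n → Ω, b (l, fun a => Function.update (x a) (i l a) (ξ a))
        ∂(Measure.pi fun _ : Fin m => Measure.pi fun _ : Fin n => μ)),
    ∫⁻ x : Fin m → Fin n → Ω, (∫⁻ l, g (l, fun a => x a (i l a)) ∂lam) ^ q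
        ∂(Measure.pi fun _ : Fin m => Measure.pi fun _ : Fin n => μ) ≤
      CL m k * ∫⁻ x : Fin m → Fin n → Ω, (∫⁻ l, g (l, fun a => x a (i l a)) * b (l, x) ∂lam) ^ q
        ∂(Measure.pi fun _ : Fin m => Measure.pi fun _ : Fin n => μ) := by
  induction m with
  | zero =>
    intro k hk1 hk i hi g hg hgt b hb hb1 hyp
    simp only [CL]
    rw [← lintegral_const_mul' _ _ hk]
    refine lintegral_mono fun x => ?_
    calc _ ≤ (k * ∫⁻ l, g (l, fun a => x a (i l a)) * b (l, x) ∂lam) ^ q := by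
          gcongr
          rw [← lintegral_const_mul' _ _ hk]
          refine lintegral_mono fun l => ?_
          dsimp only
          rcases eq_or_ne (g (l, fun a => x a (i l a))) 0 with h0 | h0
          · simp [h0]
          have h1 := hyp l _ h0
          have h2 : ∀ z : Fin 0 → Fin n → Ω, z = x := fun z => Subsingleton.elim _ _
          have h3 : ∀ z : Fin 0 → Fin n → Ω,
              (fun a => Function.update (z a) (i l a) (x a (i l a))) = x :=
            fun z => Subsingleton.elim _ _
          simp only [h3, lintegral_const, measure_univ, mul_one] at h1
          calc _ = g (l, fun a => x a (i l a)) * 1 := by simp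
            _ ≤ g (l, fun a => x a (i l a)) * (k * b (l, x)) := by gcongr
            _ = _ := by ring
      _ ≤ _ := by
          rw [ENNReal.mul_rpow_of_nonneg _ _ hq0.le]
          gcongr
          simpa using ENNReal.rpow_le_rpow_of_exponent_le hk1 hq1
  | succ m ih =>
    intro k hk1 hk i hi g hg hgt b hb hb1 hyp
    have hk2 : 1 ≤ 2 * k := by
      calc (1:ℝ≥0∞) = 1 * 1 := by simp
        _ ≤ _ := by gcongr; norm_num
    have hk2t : 2 * k ≠ ∞ := by finiteness
    have hia : ∀ a, Measurable (fun l => i l a) := fun a => (measurable_pi_apply a).comp hi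
    set φ : Λ × (Fin n → Ω) × (Fin m → Ω) → ℝ≥0∞ := fun w =>
      ∫⁻ x : Fin m → Fin n → Ω, b (w.1, Fin.cons w.2.1
        (fun a => Function.update (x a) (i w.1 a.succ) (w.2.2 a)))
        ∂(Measure.pi fun _ : Fin m => Measure.pi fun _ : Fin n => μ) with hφ
    have hφm : Measurable φ := by
      refine Measurable.lintegral_prod_right' (f := fun w : (Λ × (Fin n → Ω) × (Fin m → Ω)) ×
        (Fin m → Fin n → Ω) => b (w.1.1, Fin.cons w.1.2.1
        (fun a => Function.update (w.2 a) (i w.1.1 a.succ) (w.1.2.2 a)))) ?_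
      refine hb.comp ?_
      refine Measurable.prodMk (by fun_prop) (measurable_cons' (by fun_prop) ?_)
      refine measurable_pi_iff.2 fun a => measurable_update'' (by fun_prop) ?_ (by fun_prop)
      exact (hia _).comp (by fun_prop)
    have hφ1 : ∀ w, φ w ≤ 1 := fun w => by
      calc _ ≤ ∫⁻ x : Fin m → Fin n → Ω, 1
            ∂(Measure.pi fun _ : Fin m => Measure.pi fun _ : Fin n => μ) :=
            lintegral_mono fun x => hb1 _
        _ = 1 := by simp
    set D : Set (Λ × (Fin n → Ω) × (Fin m → Ω)) := {w | 1 ≤ 2 * k * φ w} with hD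
    have hDm : MeasurableSet D := measurableSet_le measurable_const (by fun_prop)
    have hDi : Measurable (D.indicator (1 : Λ × (Fin n → Ω) × (Fin m → Ω) → ℝ≥0∞)) := measurable_one.indicator hDm
    have hsel : Measurable (fun w : Λ × (Fin m → Fin n → Ω) => fun a => w.2 a (i w.1 a.succ)) :=
      measurable_pi_iff.2 fun a =>
        measurable_eval' (by fun_prop) ((hia _).comp (by fun_prop))
    have hsel0 : Measurable (fun w : Λ × (Fin n → Ω) => w.2 (i w.1 0)) :=
      measurable_eval' (by fun_prop) ((hia _).comp (by fun_prop))
    -- the integrand, and the truncated one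
    set A : (Fin n → Ω) → (Fin m → Fin n → Ω) → ℝ≥0∞ := fun y x =>
      ∫⁻ l, g (l, Fin.cons (y (i l 0)) (fun a => x a (i l a.succ))) ∂lam with hA
    set A' : (Fin n → Ω) → (Fin m → Fin n → Ω) → ℝ≥0∞ := fun y x =>
      ∫⁻ l, g (l, Fin.cons (y (i l 0)) (fun a => x a (i l a.succ))) *
        D.indicator 1 (l, y, fun a => x a (i l a.succ)) ∂lam with hA'
    have hgm : Measurable (fun w : ((Fin n → Ω) × (Fin m → Fin n → Ω)) × Λ =>
        g (w.2, Fin.cons (w.1.1 (i w.2 0)) (fun a => w.1.2 a (i w.2 a.succ)))) := by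
      refine hg.comp (Measurable.prodMk (by fun_prop) (measurable_cons' ?_ ?_))
      · exact hsel0.comp (f := fun w : ((Fin n → Ω) × (Fin m → Fin n → Ω)) × Λ => (w.2, w.1.1))
          (by fun_prop)
      · exact hsel.comp (f := fun w : ((Fin n → Ω) × (Fin m → Fin n → Ω)) × Λ => (w.2, w.1.2))
          (by fun_prop)
    have hgDm : Measurable (fun w : ((Fin n → Ω) × (Fin m → Fin n → Ω)) × Λ =>
        g (w.2, Fin.cons (w.1.1 (i w.2 0)) (fun a => w.1.2 a (i w.2 a.succ))) *
        D.indicator 1 (w.2, w.1.1, fun a => w.1.2 a (i w.2 a.succ))) := by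
      refine hgm.mul (hDi.comp (Measurable.prodMk (by fun_prop) (Measurable.prodMk (by fun_prop) ?_)))
      exact hsel.comp (f := fun w : ((Fin n → Ω) × (Fin m → Fin n → Ω)) × Λ => (w.2, w.1.2))
          (by fun_prop)
    have hAm : Measurable (fun w : (Fin n → Ω) × (Fin m → Fin n → Ω) => A w.1 w.2 ^ q) :=
      (hgm.lintegral_prod_right').pow_const q
    have hA'm : Measurable (fun w : (Fin n → Ω) × (Fin m → Fin n → Ω) => A' w.1 w.2 ^ q) :=
      (hgDm.lintegral_prod_right').pow_const q
    -- step in the zeroth coordinate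
    have s1 : ∀ x : Fin m → Fin n → Ω, ∫⁻ y, A y x ^ q ∂(Measure.pi fun _ : Fin n => μ) ≤
        160 * (2 * k) ^ 4 * ∫⁻ y, A' y x ^ q ∂(Measure.pi fun _ : Fin n => μ) := by
      intro x
      have hselx : Measurable (fun l : Λ => fun a => x a (i l a.succ)) :=
        hsel.comp (f := fun l => (l, x)) (by fun_prop)
      refine L1 μ lam (hia 0)
        (g := fun w : Λ × Ω => g (w.1, Fin.cons w.2 (fun a => x a (i w.1 a.succ)))) ?_
        (fun _ => hgt _)
        (b := fun w : Λ × (Fin n → Ω) => D.indicator 1 (w.1, w.2, fun a => x a (i w.1 a.succ)))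
        ?_ ?_ hq0 hq1 hk2 hk2t ?_
      · refine hg.comp (Measurable.prodMk (by fun_prop) (measurable_cons' (by fun_prop) ?_))
        exact hselx.comp measurable_fst
      · refine hDi.comp (Measurable.prodMk (by fun_prop) (Measurable.prodMk (by fun_prop) ?_))
        exact hselx.comp measurable_fst
      · intro w
        exact Set.indicator_le_self' (fun _ _ => zero_le) _
      · intro l t hl
        have h1 := hyp l _ hl
        rw [lintegral_cons] at h1
        swap
        · refine hb.comp (Measurable.prodMk (by fun_prop) ?_)
          exact measurable_pi_iff.2 fun a => measurable_update'' (by fun_prop)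
            measurable_const measurable_const
        set ξ : Fin m → Ω := fun a => x a (i l a.succ) with hξ
        have h2 : ∀ (y : Fin n → Ω), (∫⁻ z : Fin m → Fin n → Ω, b (l, fun a =>
            Function.update ((Fin.cons y z : Fin (m+1) → Fin n → Ω) a) (i l a)
              ((Fin.cons t ξ : Fin (m+1) → Ω) a))
            ∂(Measure.pi fun _ : Fin m => Measure.pi fun _ : Fin n => μ)) =
            φ (l, Function.update y (i l 0) t, ξ) := by
          intro y
          rw [hφ]
          refine lintegral_congr fun z => ?_
          congr 2
          funext a
          refine Fin.cases ?_ (fun a => ?_) a <;> simp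
        simp only [h2] at h1
        have hum : Measurable (fun y : Fin n → Ω => (l, Function.update y (i l 0) t, ξ)) :=
          Measurable.prodMk measurable_const (Measurable.prodMk
            (measurable_update'' measurable_id measurable_const measurable_const) measurable_const)
        have h3 : (1 : ℝ≥0∞) + 1 ≤ 2 * k * (∫⁻ y, D.indicator 1 (l, Function.update y (i l 0) t, ξ)
            ∂(Measure.pi fun _ : Fin n => μ)) + 1 := by
          calc (1 : ℝ≥0∞) + 1 = 2 * 1 := by norm_num
            _ ≤ 2 * (k * ∫⁻ y, φ (l, Function.update y (i l 0) t, ξ)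
                  ∂(Measure.pi fun _ : Fin n => μ)) := by gcongr
            _ = ∫⁻ y, 2 * k * φ (l, Function.update y (i l 0) t, ξ)
                  ∂(Measure.pi fun _ : Fin n => μ) := by
                rw [lintegral_const_mul' _ _ hk2t]; ring
            _ ≤ ∫⁻ y, (2 * k * D.indicator 1 (l, Function.update y (i l 0) t, ξ) + 1)
                  ∂(Measure.pi fun _ : Fin n => μ) := by
                refine lintegral_mono fun y => ?_
                dsimp only
                by_cases h : (l, Function.update y (i l 0) t, ξ) ∈ D
                · rw [Set.indicator_of_mem h]
                  refine le_trans ?_ le_self_add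
                  gcongr
                  exact hφ1 _
                · refine le_trans ?_ le_add_self
                  simp only [hD, Set.mem_ofPred_eq, not_le] at h
                  exact h.le
            _ = _ := by
                rw [lintegral_add_right _ measurable_const, lintegral_const_mul' _ _ hk2t]
                simp
        exact (ENNReal.add_le_add_iff_right (by simp)).1 h3
    -- step in the other coordinates
    have s2 : ∀ y : Fin n → Ω, ∫⁻ x : Fin m → Fin n → Ω, A' y x ^ q
          ∂(Measure.pi fun _ : Fin m => Measure.pi fun _ : Fin n => μ) ≤
        CL m (2 * k) * ∫⁻ x : Fin m → Fin n → Ω, (∫⁻ l, g (l, Fin.cons (y (i l 0))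
          (fun a => x a (i l a.succ))) * b (l, Fin.cons y x) ∂lam) ^ q
          ∂(Measure.pi fun _ : Fin m => Measure.pi fun _ : Fin n => μ) := by
      intro y
      have hsely : Measurable (fun l : Λ => y (i l 0)) :=
        hsel0.comp (f := fun l => (l, y)) (by fun_prop)
      have hm1 : Measurable (fun w : Λ × (Fin m → Ω) => g (w.1, Fin.cons (y (i w.1 0)) w.2)
            * D.indicator 1 (w.1, y, w.2)) := by
        refine Measurable.mul (hg.comp (Measurable.prodMk (by fun_prop)
          (measurable_cons' (hsely.comp measurable_fst) (by fun_prop)))) ?_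
        exact hDi.comp (by fun_prop)
      have := ih hk2 hk2t (i := fun l a => i l a.succ) (measurable_pi_iff.2 fun a => hia _)
        (g := fun w : Λ × (Fin m → Ω) => g (w.1, Fin.cons (y (i w.1 0)) w.2)
            * D.indicator 1 (w.1, y, w.2)) hm1 ?_ (b := fun w => b (w.1, Fin.cons y w.2))
            (by fun_prop) (fun _ => hb1 _) ?_
      · refine this.trans ?_
        refine mul_le_mul_right (lintegral_mono fun x => ?_) _
        refine ENNReal.rpow_le_rpow (lintegral_mono fun l => ?_) hq0.le
        refine mul_le_mul_left ?_ _
        exact mul_le_of_le_one_right zero_le (Set.indicator_le_self' (fun _ _ => zero_le) _)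
      · intro w
        refine ENNReal.mul_ne_top (hgt _) ?_
        exact ne_top_of_le_ne_top ENNReal.one_ne_top (Set.indicator_le_self' (fun _ _ => zero_le) _)
      · intro l ξ hl
        have : (l, y, ξ) ∈ D := by
          by_contra h
          simp [h] at hl
        exact this
    have hselF : Measurable (fun w : (Fin (m + 1) → Fin n → Ω) × Λ => fun a => w.1 a (i w.2 a)) :=
      measurable_pi_iff.2 fun a =>
        measurable_eval' (by fun_prop) ((hia _).comp (by fun_prop))
    have hg1 : Measurable (fun w : (Fin (m + 1) → Fin n → Ω) × Λ =>
        g (w.2, fun a => w.1 a (i w.2 a))) :=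
      hg.comp (Measurable.prodMk (by fun_prop) hselF)
    have hg2 : Measurable (fun w : (Fin (m + 1) → Fin n → Ω) × Λ =>
        g (w.2, fun a => w.1 a (i w.2 a)) * b (w.2, w.1)) :=
      hg1.mul (by fun_prop)
    rw [lintegral_cons _ _ ((hg1.lintegral_prod_right').pow_const q),
      lintegral_cons _ _ ((hg2.lintegral_prod_right').pow_const q)]
    have hc : ∀ (y : Fin n → Ω) (x : Fin m → Fin n → Ω) (l : Λ),
        (fun a => (Fin.cons y x : Fin (m + 1) → Fin n → Ω) a (i l a)) =
          (Fin.cons (y (i l 0)) (fun a => x a (i l a.succ)) : Fin (m + 1) → Ω) := by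
      intro y x l
      funext a
      refine Fin.cases ?_ (fun a => ?_) a <;> simp
    simp only [hc]
    rw [lintegral_lintegral_swap (f := fun y x => A y x ^ q) hAm.aemeasurable]
    calc _ ≤ ∫⁻ x : Fin m → Fin n → Ω, 160 * (2 * k) ^ 4 * ∫⁻ y, A' y x ^ q
          ∂(Measure.pi fun _ : Fin n => μ)
          ∂(Measure.pi fun _ : Fin m => Measure.pi fun _ : Fin n => μ) := lintegral_mono s1
      _ = 160 * (2 * k) ^ 4 * ∫⁻ y : Fin n → Ω, ∫⁻ x : Fin m → Fin n → Ω, A' y x ^ q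
          ∂(Measure.pi fun _ : Fin m => Measure.pi fun _ : Fin n => μ)
          ∂(Measure.pi fun _ : Fin n => μ) := by
          rw [lintegral_const_mul' _ _ (by finiteness),
            lintegral_lintegral_swap (f := fun y x => A' y x ^ q) hA'm.aemeasurable]
      _ ≤ _ := by
          rw [CL, mul_assoc (160 * (2 * k) ^ 4)]
          refine mul_le_mul_right ?_ _
          rw [← lintegral_const_mul' _ _ (CL_ne_top m _ hk2t)]
          exact lintegral_mono s2

end Lm

section MN

/-- Recursive mixed norm: the coordinates `k` with `J k = true` are inner, the others outer. -/
noncomputable def MN (q : ℝ) {Z : Type u} [MeasurableSpace Z] (ν : Measure Z) :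
    ∀ (m : ℕ) (_ : Fin m → Bool) {Θ Λ : Type u} [MeasurableSpace Θ] [MeasurableSpace Λ]
      (_ : Measure Θ) (_ : Measure Λ) (_ : Θ × Λ × (Fin m → Z) → ℝ≥0∞), ℝ≥0∞
  | 0, _, _, _, _, _, θ, lam, g => ∫⁻ ϑ, (∫⁻ l, g (ϑ, l, Fin.elim0) ∂lam) ^ q ∂θ
  | m + 1, J, _, _, _, _, θ, lam, g =>
    if J 0 = true then
      MN q ν m (fun k => J k.succ) θ (lam.prod ν) (fun w => g (w.1, w.2.1.1, Fin.cons w.2.1.2 w.2.2))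
    else
      MN q ν m (fun k => J k.succ) (θ.prod ν) lam (fun w => g (w.1.1, w.2.1, Fin.cons w.1.2 w.2.2))

theorem lm_succ {Z : Type*} [MeasurableSpace Z] (ν : Measure Z) [SigmaFinite ν] {m : ℕ}
    (s : Finset (Fin m)) {F : (Fin (m + 1) → Z) → ℝ≥0∞} (hF : Measurable F) (t : Z)
    (x : Fin m → Z) :
    lmarginal (fun _ => ν) (s.image Fin.succ) F (Fin.cons t x : Fin (m + 1) → Z) =
      lmarginal (fun _ => ν) s (fun z => F (Fin.cons t z)) x := by
  have h := lmarginal_image (X := fun _ : Fin (m + 1) => Z) (μ := fun _ => ν)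
    (Fin.succ_injective m) s (f := fun z => F (Fin.cons t z)) (by fun_prop)
    (Fin.cons t x : Fin (m + 1) → Z)
  have e1 : ((Fin.cons t x : Fin (m + 1) → Z) ∘ Fin.succ) = x := by
    funext k; simp
  refine Eq.trans ?_ (h.trans ?_)
  · unfold lmarginal
    refine lintegral_congr fun y => ?_
    simp only [Function.comp_def]
    congr 1
    funext k
    refine Fin.cases ?_ (fun k => ?_) k
    · simp [Function.updateFinset]
    · simp
  · rfl

theorem measurable_lmarginal_param {Z α : Type*} [MeasurableSpace Z] [MeasurableSpace α]
    (ν : Measure Z) [SigmaFinite ν] {m : ℕ} (s : Finset (Fin m))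
    {F : α × (Fin m → Z) → ℝ≥0∞} (hF : Measurable F) :
    Measurable (fun w : α × (Fin m → Z) =>
      lmarginal (fun _ => ν) s (fun z => F (w.1, z)) w.2) := by
  unfold lmarginal
  refine Measurable.lintegral_prod_right' (f := fun w : (α × (Fin m → Z)) × (s → Z) =>
    F (w.1.1, Function.updateFinset w.1.2 s w.2)) ?_
  refine hF.comp (Measurable.prodMk (by fun_prop) ?_)
  exact (measurable_updateFinset' (X := fun _ : Fin m => Z)).comp
    (by fun_prop : Measurable fun w : (α × (Fin m → Z)) × (s → Z) => (w.1.2, w.2))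

theorem filter_succ {m : ℕ} (P : Fin (m + 1) → Prop) [DecidablePred P] :
    (Finset.univ.filter P) = if P 0 then
      insert 0 ((Finset.univ.filter fun k : Fin m => P k.succ).image Fin.succ) else
      ((Finset.univ.filter fun k : Fin m => P k.succ).image Fin.succ) := by
  ext k
  refine Fin.cases ?_ (fun k => ?_) k <;> split_ifs <;> simp_all

theorem MN_eq {q : ℝ} {Z : Type u} [MeasurableSpace Z] (ν : Measure Z) [SigmaFinite ν] (m : ℕ) :
    ∀ (J : Fin m → Bool) {Θ Λ : Type u} [MeasurableSpace Θ] [MeasurableSpace Λ]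
      (θ : Measure Θ) (lam : Measure Λ) [SigmaFinite θ] [SigmaFinite lam]
      {g : Θ × Λ × (Fin m → Z) → ℝ≥0∞} (_ : Measurable g) (z0 : Fin m → Z),
      MN q ν m J θ lam g = ∫⁻ ϑ, lmarginal (fun _ => ν) (Finset.univ.filter fun k => J k = false)
        (fun z => (∫⁻ l, lmarginal (fun _ => ν) (Finset.univ.filter fun k => J k = true)
          (fun z' => g (ϑ, l, z')) z ∂lam) ^ q) z0 ∂θ := by
  induction m with
  | zero =>
    intro J Θ Λ _ _ θ lam _ _ g hg z0
    have : z0 = Fin.elim0 := Subsingleton.elim _ _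
    simp [MN, this]
  | succ m ih =>
    intro J Θ Λ _ _ θ lam _ _ g hg z0
    obtain ⟨t0, x0, rfl⟩ : ∃ t x, z0 = (Fin.cons t x : Fin (m + 1) → Z) :=
      ⟨z0 0, Fin.tail z0, (Fin.cons_self_tail z0).symm⟩
    set Jf := (Finset.univ.filter fun k : Fin m => J k.succ = false) with hJf
    set Jt := (Finset.univ.filter fun k : Fin m => J k.succ = true) with hJt
    rw [filter_succ (fun k => J k = false), filter_succ (fun k => J k = true), ← hJf, ← hJt]
    have hlm : ∀ s : Finset (Fin (m+1)), Measurable (fun w : Θ × Λ × (Fin (m+1) → Z) =>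
        lmarginal (fun _ => ν) s (fun z' => g (w.1, w.2.1, z')) w.2.2) := by
      intro s
      have := measurable_lmarginal_param ν s
        (F := fun w : (Θ × Λ) × (Fin (m+1) → Z) => g (w.1.1, w.1.2, w.2)) (by fun_prop)
      exact this.comp (by fun_prop :
        Measurable fun w : Θ × Λ × (Fin (m+1) → Z) => ((w.1, w.2.1), w.2.2))
    have hlm2 : ∀ s : Finset (Fin (m+1)), Measurable (fun w : Θ × (Fin (m+1) → Z) =>
        (∫⁻ l, lmarginal (fun _ => ν) s (fun z' => g (w.1, l, z')) w.2 ∂lam) ^ q) := by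
      intro s
      refine Measurable.pow_const ?_ q
      exact Measurable.lintegral_prod_right' (f := fun w : (Θ × (Fin (m+1) → Z)) × Λ =>
        lmarginal (fun _ => ν) s (fun z' => g (w.1.1, w.2, z')) w.1.2)
        ((hlm s).comp (by fun_prop : Measurable fun w : (Θ × (Fin (m+1) → Z)) × Λ =>
          (w.1.1, w.2, w.1.2)))
    have e : ∀ ϑ l t z, lmarginal (fun _ => ν) Jt (fun z' => g (ϑ, l, Fin.cons t z')) z =
        lmarginal (fun _ => ν) (Jt.image Fin.succ) (fun z' => g (ϑ, l, z')) (Fin.cons t z) :=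
      fun ϑ l t z => (lm_succ ν Jt (F := fun z' => g (ϑ, l, z')) (by fun_prop) t z).symm
    rcases h0 : J 0 with _ | _
    · -- outer
      simp only [Bool.false_eq_true, if_true, if_false]
      rw [MN, if_neg (by simp [h0]), ih _ _ _ (by fun_prop) x0]
      simp only [← hJf, ← hJt, e]
      rw [lintegral_prod]
      swap
      · apply Measurable.aemeasurable
        have h1 := measurable_lmarginal_param ν Jf (F := fun w : (Θ × Z) × (Fin m → Z) =>
          (∫⁻ l, lmarginal (fun _ => ν) (Jt.image Fin.succ) (fun z' => g (w.1.1, l, z'))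
            (Fin.cons w.1.2 w.2) ∂lam) ^ q)
            ((hlm2 (Jt.image Fin.succ)).comp (by fun_prop :
              Measurable fun w : (Θ × Z) × (Fin m → Z) =>
                (w.1.1, (Fin.cons w.1.2 w.2 : Fin (m+1) → Z))))
        have h2 := h1.comp (by fun_prop : Measurable fun w : Θ × Z => (w, x0))
        exact h2
      refine lintegral_congr fun ϑ => ?_
      rw [lmarginal_insert]
      rotate_left
      · exact (hlm2 _).comp (by fun_prop : Measurable fun z => (ϑ, z))
      · simp
      refine lintegral_congr fun t => ?_
      rw [Fin.update_cons_zero, lm_succ]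
      exact (hlm2 _).comp (by fun_prop : Measurable fun z => (ϑ, z))
    · simp only [Bool.true_eq_false, if_true, if_false]
      rw [MN, if_pos (by simp [h0]), ih _ _ _ (by fun_prop) x0]
      simp only [← hJf, ← hJt, e]
      refine lintegral_congr fun ϑ => ?_
      rw [lm_succ]
      swap
      · exact (hlm2 _).comp (by fun_prop : Measurable fun z => (ϑ, z))
      congr 1
      funext z
      congr 1
      rw [lintegral_prod]
      swap
      · exact ((hlm (Jt.image Fin.succ)).comp (by fun_prop : Measurable fun w : Λ × Z =>
          (ϑ, w.1, (Fin.cons w.2 z : Fin (m+1) → Z)))).aemeasurable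
      refine lintegral_congr fun l => ?_
      rw [lmarginal_insert]
      rotate_left
      · fun_prop
      · simp
      refine lintegral_congr fun t => ?_
      rw [Fin.update_cons_zero]

end MN

section conn

theorem pi_count' {ι : Type*} [Fintype ι] (n : ℕ) :
    Measure.pi (fun _ : ι => (Measure.count : Measure (Fin n))) = Measure.count := by
  classical
  refine Measure.ext_of_singleton fun i => ?_
  rw [Measure.pi_singleton]
  simp

theorem lintegral_pi_prod_count {ι Ω : Type*} [Fintype ι] [MeasurableSpace Ω] (μ : Measure Ω)
    [SigmaFinite μ] (n : ℕ) [DecidableEq ι] {F : (ι → Fin n × Ω) → ℝ≥0∞} (hF : Measurable F) :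
    ∫⁻ w, F w ∂(Measure.pi fun _ : ι => (Measure.count : Measure (Fin n)).prod μ) =
      ∑ i : ι → Fin n, ∫⁻ ξ : ι → Ω, F (fun k => (i k, ξ k)) ∂(Measure.pi fun _ : ι => μ) := by
  have h := (measurePreserving_arrowProdEquivProdArrow (Fin n) Ω ι
    (fun _ => Measure.count) (fun _ => μ)).symm
  rw [← h.lintegral_comp hF, lintegral_prod, pi_count', lintegral_count, tsum_fintype]
  · rfl
  · exact (hF.comp (MeasurableEquiv.measurable _)).aemeasurable

theorem lintegral_reindex {ι Z : Type*} [MeasurableSpace Z] (ν : Measure Z)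
    (s : Finset ι) (P : ι → Prop) [Fintype {k // P k}] (h : ∀ k, k ∈ s ↔ P k)
    (F : ({k // k ∈ s} → Z) → ℝ≥0∞) :
    ∫⁻ y, F y ∂(Measure.pi fun _ : {k // k ∈ s} => ν) =
      ∫⁻ y : {k // P k} → Z, F (fun k => y ⟨k.1, (h k.1).1 k.2⟩)
        ∂(Measure.pi fun _ : {k // P k} => ν) := by
  obtain rfl : P = (· ∈ s) := by funext k; exact propext (h k).symm
  congr!

variable {Ω : Type u} [MeasurableSpace Ω]

/-- The nonnegative function on the product of disjoint unions attached to a family. -/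
noncomputable def gof (p : ℝ) {n m : ℕ} (a : (Fin m → Fin n) → (Fin m → Ω) → ℝ) :
    PUnit.{u+1} × PUnit.{u+1} × (Fin m → Fin n × Ω) → ℝ≥0∞ :=
  fun w => ENNReal.ofReal (|a (fun k => (w.2.2 k).1) (fun k => (w.2.2 k).2)| ^ p)

theorem measurable_gof0 {p : ℝ} {n m : ℕ} {a : (Fin m → Fin n) → (Fin m → Ω) → ℝ}
    (ha : ∀ i, Measurable (a i)) :
    Measurable (fun z : Fin m → Fin n × Ω => a (fun k => (z k).1) (fun k => (z k).2)) := by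
  have : Measurable (fun w : (Fin m → Fin n) × (Fin m → Ω) => a w.1 w.2) :=
    measurable_from_prod_countable_right fun i => ha i
  exact this.comp (by fun_prop : Measurable fun z : Fin m → Fin n × Ω =>
    ((fun k => (z k).1), (fun k => (z k).2)))

theorem measurable_gof {p : ℝ} {n m : ℕ} {a : (Fin m → Fin n) → (Fin m → Ω) → ℝ}
    (ha : ∀ i, Measurable (a i)) : Measurable (gof p a) := by
  have := measurable_gof0 (p := p) ha
  unfold gof
  refine ENNReal.measurable_ofReal.comp (Measurable.pow_const ?_ p)
  exact (measurable_gof0 (p := p) ha |>.comp (by fun_prop : Measurable fun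
    w : PUnit.{u+1} × PUnit.{u+1} × (Fin m → Fin n × Ω) => w.2.2)).abs

theorem mixedNorm_eq (μ : Measure Ω) [IsProbabilityMeasure μ] (p : ℝ) {n m : ℕ}
    (J : Finset (Fin m)) {a : (Fin m → Fin n) → (Fin m → Ω) → ℝ} (ha : ∀ i, Measurable (a i))
    (z0 : Fin m → Fin n × Ω) :
    mixedNorm μ p J a = MN (1/p) ((Measure.count : Measure (Fin n)).prod μ) m
      (fun k => decide (k ∈ J)) (Measure.dirac PUnit.unit) (Measure.dirac PUnit.unit)
      (gof p a) := by
  set ν := (Measure.count : Measure (Fin n)).prod μ with hν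
  have hgm := measurable_gof (p := p) ha
  rw [MN_eq ν m _ _ _ hgm z0]
  simp only [lintegral_dirac]
  unfold lmarginal
  rw [lintegral_reindex ν _ (fun k => k ∉ J) (by simp)]
  have key1 : ∀ y, (∫⁻ w, gof p a (PUnit.unit, PUnit.unit, Function.updateFinset y
      (Finset.univ.filter fun k => decide (k ∈ J) = true) w) ∂(Measure.pi fun _ => ν)) =
      ∑ i'' : {k // k ∈ J} → Fin n, ∫⁻ ξ'' : {k // k ∈ J} → Ω,
        gof p a (PUnit.unit, PUnit.unit, fun k =>
          if h : k ∈ J then (i'' ⟨k, h⟩, ξ'' ⟨k, h⟩) else y k) ∂Measure.pi fun _ => μ := by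
    intro y
    rw [lintegral_reindex ν _ (fun k => k ∈ J) (by simp), lintegral_pi_prod_count]
    · refine Finset.sum_congr rfl fun i'' _ => lintegral_congr fun ξ'' => ?_
      congr 3
      funext k
      by_cases h : k ∈ J <;> simp [h, Function.updateFinset]
    · refine hgm.comp (Measurable.prodMk measurable_const (Measurable.prodMk measurable_const ?_))
      refine measurable_pi_iff.2 fun k => ?_
      simp only [Function.updateFinset]
      split_ifs <;> fun_prop
  simp only [key1]
  rw [lintegral_pi_prod_count]
  · unfold mixedNorm gof
    refine Finset.sum_congr rfl fun i' _ => lintegral_congr fun ξ' => ?_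
    congr 1
    refine Finset.sum_congr rfl fun i'' _ => lintegral_congr fun ξ'' => ?_
    dsimp only
    congr 4
    · funext k
      by_cases h : k ∈ J <;> simp [h, Function.updateFinset]
    · funext k
      by_cases h : k ∈ J <;> simp [h, Function.updateFinset]
  · refine Measurable.pow_const ?_ _
    refine Finset.measurable_sum _ fun i'' _ => ?_
    refine Measurable.lintegral_prod_right' (f := fun w : ({k // k ∉ J} → Fin n × Ω) ×
      ({k // k ∈ J} → Ω) => gof p a (PUnit.unit, PUnit.unit, fun k => if h : k ∈ J then
        (i'' ⟨k, h⟩, w.2 ⟨k, h⟩) else Function.updateFinset z0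
          (Finset.univ.filter fun k => decide (k ∈ J) = false) (fun k => w.1 ⟨k.1, by simpa using k.2⟩) k)) ?_
    refine hgm.comp (Measurable.prodMk measurable_const (Measurable.prodMk measurable_const ?_))
    refine measurable_pi_iff.2 fun k => ?_
    simp only [Function.updateFinset]
    split_ifs <;> fun_prop

end conn

section UU
variable {Ω : Type u} [MeasurableSpace Ω] {n : ℕ}

/-- The averaged norm. -/
noncomputable def UU (q : ℝ) (μ : Measure Ω) (n m : ℕ) {Θ Λ : Type u} [MeasurableSpace Θ]
    [MeasurableSpace Λ] (θ : Measure Θ) (lam : Measure Λ)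
    (g : Θ × Λ × (Fin m → Fin n × Ω) → ℝ≥0∞) : ℝ≥0∞ :=
  ∫⁻ ϑ, ∫⁻ x : Fin m → Fin n → Ω, (∫⁻ l, ∑ i : Fin m → Fin n,
    g (ϑ, l, fun k => (i k, x k (i k))) ∂lam) ^ q
    ∂(Measure.pi fun _ : Fin m => Measure.pi fun _ : Fin n => μ) ∂θ

/-- The partial sum with the zeroth coordinate frozen. -/
noncomputable def KK {m : ℕ} {Θ Λ : Type u} [MeasurableSpace Λ] (lam : Measure Λ)
    (g : Θ × Λ × (Fin (m + 1) → Fin n × Ω) → ℝ≥0∞)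
    (w : Θ × (Fin n × Ω) × (Fin m → Fin n → Ω)) : ℝ≥0∞ :=
  ∫⁻ l, ∑ i : Fin m → Fin n, g (w.1, l, Fin.cons w.2.1 (fun k => (i k, w.2.2 k (i k)))) ∂lam

variable {m : ℕ} {Θ Λ : Type u} [MeasurableSpace Θ] [MeasurableSpace Λ] (θ : Measure Θ)
  (lam : Measure Λ) [SigmaFinite θ] [SigmaFinite lam]

theorem measurable_KK {g : Θ × Λ × (Fin (m + 1) → Fin n × Ω) → ℝ≥0∞} (hg : Measurable g) :
    Measurable (KK lam g) := by
  unfold KK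
  refine Measurable.lintegral_prod_right' (f := fun w : (Θ × (Fin n × Ω) × (Fin m → Fin n → Ω)) × Λ
    => ∑ i : Fin m → Fin n, g (w.1.1, w.2, Fin.cons w.1.2.1 (fun k => (i k, w.1.2.2 k (i k))))) ?_
  fun_prop

variable (μ : Measure Ω) [IsProbabilityMeasure μ]

theorem lintegral_nu {F : Fin n × Ω → ℝ≥0∞} (hF : Measurable F) :
    ∫⁻ z, F z ∂((Measure.count : Measure (Fin n)).prod μ) = ∑ j, ∫⁻ t, F (j, t) ∂μ := by
  rw [lintegral_prod _ hF.aemeasurable, lintegral_count, tsum_fintype]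

theorem UU_succ {q : ℝ} {g : Θ × Λ × (Fin (m + 1) → Fin n × Ω) → ℝ≥0∞} (hg : Measurable g) :
    UU q μ n (m + 1) θ lam g = ∫⁻ ϑ, ∫⁻ x : Fin m → Fin n → Ω, ∫⁻ y : Fin n → Ω,
      (∑ j, KK lam g (ϑ, (j, y j), x)) ^ q ∂(Measure.pi fun _ : Fin n => μ)
      ∂(Measure.pi fun _ : Fin m => Measure.pi fun _ : Fin n => μ) ∂θ := by
  unfold UU
  refine lintegral_congr fun ϑ => ?_
  have hK := measurable_KK lam hg
  rw [lintegral_cons]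
  swap
  · refine Measurable.pow_const ?_ q
    refine Measurable.lintegral_prod_right' (f := fun w : (Fin (m+1) → Fin n → Ω) × Λ =>
      ∑ i : Fin (m+1) → Fin n, g (ϑ, w.2, fun k => (i k, w.1 k (i k)))) ?_
    fun_prop
  rw [← lintegral_lintegral_swap (f := fun (y : Fin n → Ω) x => (∑ j, KK lam g (ϑ, (j, y j), x)) ^ q)]
  swap
  · refine Measurable.aemeasurable ?_
    simp only [Function.uncurry_def]
    fun_prop
  refine lintegral_congr fun y => lintegral_congr fun x => ?_
  congr 1
  unfold KK
  rw [← lintegral_finsetSum _ (by intros; fun_prop)]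
  refine lintegral_congr fun l => ?_
  rw [sum_cons]
  refine Finset.sum_congr rfl fun j _ => Finset.sum_congr rfl fun i _ => ?_
  congr 3
  funext k
  refine Fin.cases ?_ (fun k => ?_) k <;> simp

theorem UU_false {q : ℝ} {g : Θ × Λ × (Fin (m + 1) → Fin n × Ω) → ℝ≥0∞} (hg : Measurable g) :
    UU q μ n m (θ.prod ((Measure.count : Measure (Fin n)).prod μ)) lam
      (fun w => g (w.1.1, w.2.1, Fin.cons w.1.2 w.2.2)) =
    ∫⁻ ϑ, ∫⁻ x : Fin m → Fin n → Ω, ∑ j, ∫⁻ t, KK lam g (ϑ, (j, t), x) ^ q ∂μ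
      ∂(Measure.pi fun _ : Fin m => Measure.pi fun _ : Fin n => μ) ∂θ := by
  have hK := measurable_KK lam hg
  have : UU q μ n m (θ.prod ((Measure.count : Measure (Fin n)).prod μ)) lam
      (fun w => g (w.1.1, w.2.1, Fin.cons w.1.2 w.2.2)) =
      ∫⁻ w : Θ × Fin n × Ω, ∫⁻ x : Fin m → Fin n → Ω, KK lam g (w.1, w.2, x) ^ q
      ∂(Measure.pi fun _ : Fin m => Measure.pi fun _ : Fin n => μ)
      ∂(θ.prod ((Measure.count : Measure (Fin n)).prod μ)) := rfl
  rw [this, lintegral_prod]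
  swap
  · exact (Measurable.lintegral_prod_right' (f := fun w : (Θ × Fin n × Ω) × (Fin m → Fin n → Ω) =>
      KK lam g (w.1.1, w.1.2, w.2) ^ q) (by fun_prop)).aemeasurable
  refine lintegral_congr fun ϑ => ?_
  rw [lintegral_lintegral_swap]
  swap
  · refine Measurable.aemeasurable ?_
    simp only [Function.uncurry_def]
    fun_prop
  refine lintegral_congr fun x => ?_
  rw [lintegral_nu _ (by fun_prop)]

theorem KK_int {g : Θ × Λ × (Fin (m + 1) → Fin n × Ω) → ℝ≥0∞} (hg : Measurable g) (ϑ : Θ)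
    (x : Fin m → Fin n → Ω) :
    (∫⁻ l : Λ × Fin n × Ω, ∑ i : Fin m → Fin n,
      g (ϑ, l.1, Fin.cons l.2 (fun k => (i k, x k (i k))))
      ∂(lam.prod ((Measure.count : Measure (Fin n)).prod μ))) =
    ∑ j, ∫⁻ t, KK lam g (ϑ, (j, t), x) ∂μ := by
  have hK := measurable_KK lam hg
  rw [lintegral_prod _ (by fun_prop), lintegral_lintegral_swap]
  swap
  · refine Measurable.aemeasurable ?_
    simp only [Function.uncurry_def]
    fun_prop
  exact lintegral_nu μ (F := fun z => KK lam g (ϑ, z, x)) (by fun_prop)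

theorem UU_true {q : ℝ} {g : Θ × Λ × (Fin (m + 1) → Fin n × Ω) → ℝ≥0∞} (hg : Measurable g) :
    UU q μ n m θ (lam.prod ((Measure.count : Measure (Fin n)).prod μ))
      (fun w => g (w.1, w.2.1.1, Fin.cons w.2.1.2 w.2.2)) =
    ∫⁻ ϑ, ∫⁻ x : Fin m → Fin n → Ω, (∑ j, ∫⁻ t, KK lam g (ϑ, (j, t), x) ∂μ) ^ q
      ∂(Measure.pi fun _ : Fin m => Measure.pi fun _ : Fin n => μ) ∂θ := by
  unfold UU
  refine lintegral_congr fun ϑ => lintegral_congr fun x => ?_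
  dsimp only
  rw [KK_int lam μ hg]

theorem lintegral_pi_eval {F : Ω → ℝ≥0∞} (hF : Measurable F) (j : Fin n) :
    ∫⁻ y : Fin n → Ω, F (y j) ∂(Measure.pi fun _ : Fin n => μ) = ∫⁻ t, F t ∂μ :=
  (measurePreserving_eval (fun _ : Fin n => μ) j).lintegral_comp hF

end UU

theorem UU_le_MN {Ω : Type u} [MeasurableSpace Ω] {n : ℕ} (μ : Measure Ω) [IsProbabilityMeasure μ]
    {q : ℝ} (hq0 : 0 < q) (hq1 : q ≤ 1) (m : ℕ) :
    ∀ (J : Fin m → Bool) {Θ Λ : Type u} [MeasurableSpace Θ] [MeasurableSpace Λ]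
      (θ : Measure Θ) (lam : Measure Λ) [SigmaFinite θ] [SigmaFinite lam]
      {g : Θ × Λ × (Fin m → Fin n × Ω) → ℝ≥0∞} (_ : Measurable g),
      UU q μ n m θ lam g ≤ MN q ((Measure.count : Measure (Fin n)).prod μ) m J θ lam g := by
  induction m with
  | zero =>
    intro J Θ Λ _ _ θ lam _ _ g hg
    unfold UU MN
    refine lintegral_mono fun ϑ => le_of_eq ?_
    have : ∀ f : Fin 0 → Fin n × Ω, f = Fin.elim0 := fun f => Subsingleton.elim _ _
    simp [this]
  | succ m ih =>
    intro J Θ Λ _ _ θ lam _ _ g hg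
    have hK := measurable_KK lam hg
    rw [MN, UU_succ θ lam μ hg]
    split_ifs
    · refine le_trans ?_ (ih _ _ _ (by fun_prop))
      rw [UU_true θ lam μ hg]
      refine lintegral_mono fun ϑ => lintegral_mono fun x => ?_
      refine (jensen_rpow _ (by fun_prop) hq0 hq1).trans (le_of_eq ?_)
      rw [lintegral_finsetSum _ (by intros; fun_prop)]
      congr 1
      exact Finset.sum_congr rfl fun j _ =>
        lintegral_pi_eval μ (F := fun t => KK lam g (ϑ, (j, t), x)) (by fun_prop) j
    · refine le_trans ?_ (ih _ _ _ (by fun_prop))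
      rw [UU_false θ lam μ hg]
      refine lintegral_mono fun ϑ => lintegral_mono fun x => ?_
      refine (lintegral_mono fun y => sum_rpow_le_aux _ _ hq0 hq1).trans (le_of_eq ?_)
      rw [lintegral_finsetSum _ (by intros; fun_prop)]
      exact Finset.sum_congr rfl fun j _ =>
        lintegral_pi_eval μ (F := fun t => KK lam g (ϑ, (j, t), x) ^ q) (by fun_prop) j

theorem Lm_sum {Ω : Type u} [MeasurableSpace Ω] {n : ℕ} (μ : Measure Ω)
    [IsProbabilityMeasure μ] {q : ℝ} (hq0 : 0 < q) (hq1 : q ≤ 1) {m : ℕ}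
    {L : Type u} [MeasurableSpace L] (lam : Measure L) [SigmaFinite lam] {k : ℝ≥0∞} (hk1 : 1 ≤ k)
    (hk : k ≠ ∞) {h : L × (Fin m → Fin n × Ω) → ℝ≥0∞} (hh : Measurable h) (hht : ∀ w, h w ≠ ∞)
    {b : L × (Fin m → Fin n → Ω) → ℝ≥0∞} (hb : Measurable b) (hb1 : ∀ w, b w ≤ 1)
    (hyp : ∀ l z, h (l, z) ≠ 0 → 1 ≤ k * ∫⁻ x : Fin m → Fin n → Ω,
      b (l, fun a => Function.update (x a) (z a).1 (z a).2)
      ∂(Measure.pi fun _ : Fin m => Measure.pi fun _ : Fin n => μ)) :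
    ∫⁻ x : Fin m → Fin n → Ω, (∫⁻ l, ∑ i : Fin m → Fin n,
        h (l, fun a => (i a, x a (i a))) ∂lam) ^ q
        ∂(Measure.pi fun _ : Fin m => Measure.pi fun _ : Fin n => μ) ≤
      CL m k * ∫⁻ x : Fin m → Fin n → Ω, (∫⁻ l, (∑ i : Fin m → Fin n,
        h (l, fun a => (i a, x a (i a)))) * b (l, x) ∂lam) ^ q
        ∂(Measure.pi fun _ : Fin m => Measure.pi fun _ : Fin n => μ) := by
  have hcount : ∀ F : L × (Fin m → Fin n) → ℝ≥0∞, Measurable F →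
      ∫⁻ w, F w ∂(lam.prod Measure.count) = ∫⁻ l, ∑ i, F (l, i) ∂lam := by
    intro F hF
    rw [lintegral_prod _ hF.aemeasurable]
    simp only [lintegral_count, tsum_fintype]
  have hsel : ∀ x : Fin m → Fin n → Ω, Measurable (fun w : L × (Fin m → Fin n) =>
      (w.1, fun a => (w.2 a, x a (w.2 a)))) := by
    intro x
    refine Measurable.prodMk (by fun_prop) (measurable_pi_iff.2 fun a =>
      Measurable.prodMk (by fun_prop) (measurable_eval' (by fun_prop) (by fun_prop)))
  have := Lm μ (lam.prod (Measure.count : Measure (Fin m → Fin n))) hq0 hq1 m hk1 hk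
    (i := fun w => w.2) (by fun_prop)
    (g := fun w => h (w.1.1, fun a => (w.1.2 a, w.2 a))) (by fun_prop) (fun _ => hht _)
    (b := fun w => b (w.1.1, w.2)) (by fun_prop) (fun _ => hb1 _)
    (fun l ξ hl => hyp l.1 (fun a => (l.2 a, ξ a)) hl)
  refine (le_of_eq_of_le ?_ this).trans_eq ?_
  · refine lintegral_congr fun x => ?_
    rw [hcount]
    exact hh.comp (hsel x)
  · congr 1
    refine lintegral_congr fun x => ?_
    rw [hcount]
    · simp only [Finset.sum_mul]
    · exact (hh.comp (hsel x)).mul (by fun_prop)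

theorem compl_half {X Y : Type*} [MeasurableSpace X] [MeasurableSpace Y] (P : Measure X)
    [IsProbabilityMeasure P] {B : Set Y} (hB : MeasurableSet B) {h : X → Y} (hh : Measurable h)
    (hw : ¬ 1 ≤ 2 * ∫⁻ x, B.indicator (1 : Y → ℝ≥0∞) (h x) ∂P) :
    1 ≤ 2 * ∫⁻ x, Bᶜ.indicator (1 : Y → ℝ≥0∞) (h x) ∂P := by
  have h1 : (∫⁻ x, B.indicator (1 : Y → ℝ≥0∞) (h x) ∂P) +
      ∫⁻ x, Bᶜ.indicator (1 : Y → ℝ≥0∞) (h x) ∂P = 1 := by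
    rw [← lintegral_add_left (f := fun x => B.indicator (1 : Y → ℝ≥0∞) (h x))
      ((measurable_one.indicator hB).comp hh)]
    have : ∀ x, B.indicator (1 : Y → ℝ≥0∞) (h x) + Bᶜ.indicator (1 : Y → ℝ≥0∞) (h x) = 1 := by
      intro x
      by_cases h' : h x ∈ B <;> simp [h']
    simp [this]
  have h2 : 1 + 1 ≤ 1 + 2 * ∫⁻ x, Bᶜ.indicator (1 : Y → ℝ≥0∞) (h x) ∂P := by
    calc (1 : ℝ≥0∞) + 1 = 2 * 1 := by norm_num
      _ = 2 * (∫⁻ x, B.indicator (1 : Y → ℝ≥0∞) (h x) ∂P) +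
          2 * ∫⁻ x, Bᶜ.indicator (1 : Y → ℝ≥0∞) (h x) ∂P := by rw [← h1, mul_add]
      _ ≤ _ := by
        have := (not_le.1 hw).le
        gcongr
  exact (ENNReal.add_le_add_iff_left (by simp)).1 h2

theorem fub {Ω Θ X : Type*} [MeasurableSpace Ω] [MeasurableSpace Θ] [MeasurableSpace X] {n : ℕ}
    (μ : Measure Ω) [IsProbabilityMeasure μ] (θ : Measure Θ) [SigmaFinite θ] (P : Measure X)
    [SigmaFinite P] {F : Θ × (Fin n × Ω) × X → ℝ≥0∞} (hF : Measurable F) :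
    ∫⁻ w : Θ × Fin n × Ω, ∫⁻ x, F (w.1, w.2, x) ∂P
      ∂(θ.prod ((Measure.count : Measure (Fin n)).prod μ)) =
    ∫⁻ ϑ, ∫⁻ x, ∑ j, ∫⁻ t, F (ϑ, (j, t), x) ∂μ ∂P ∂θ := by
  rw [lintegral_prod]
  swap
  · exact (Measurable.lintegral_prod_right' (f := fun w : (Θ × Fin n × Ω) × X =>
      F (w.1.1, w.1.2, w.2)) (by fun_prop)).aemeasurable
  refine lintegral_congr fun ϑ => ?_
  rw [lintegral_lintegral_swap]
  swap
  · refine Measurable.aemeasurable ?_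
    simp only [Function.uncurry_def]
    fun_prop
  refine lintegral_congr fun x => ?_
  rw [lintegral_nu _ (by fun_prop)]

set_option maxHeartbeats 1000000 in
theorem upper_step {Ω : Type u} [MeasurableSpace Ω] {n : ℕ} (μ : Measure Ω)
    [IsProbabilityMeasure μ] {q : ℝ} (hq0 : 0 < q) (hq1 : q ≤ 1) {m : ℕ}
    {Θ Λ : Type u} [MeasurableSpace Θ] [MeasurableSpace Λ]
    (θ : Measure Θ) (lam : Measure Λ) [SigmaFinite θ] [SigmaFinite lam]
    {g : Θ × Λ × (Fin (m + 1) → Fin n × Ω) → ℝ≥0∞} (hg : Measurable g) (hgt : ∀ w, g w ≠ ∞) :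
    ∃ A : Set (Θ × (Fin n × Ω) × (Fin m → Fin n × Ω)), MeasurableSet A ∧
      UU q μ n m (θ.prod ((Measure.count : Measure (Fin n)).prod μ)) lam
        (fun w => g (w.1.1, w.2.1, Fin.cons w.1.2 w.2.2) * A.indicator 1 (w.1.1, w.1.2, w.2.2)) ≤
        CL m 2 * 80 * UU q μ n (m + 1) θ lam g ∧
      UU q μ n m θ (lam.prod ((Measure.count : Measure (Fin n)).prod μ))
        (fun w => g (w.1, w.2.1.1, Fin.cons w.2.1.2 w.2.2) * Aᶜ.indicator 1 (w.1, w.2.1.2, w.2.2)) ≤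
        CL m 2 * 80 * UU q μ n (m + 1) θ lam g := by
  have hK := measurable_KK lam hg
  have hCL : CL m 2 ≠ ∞ := CL_ne_top m 2 (by simp)
  set P := (Measure.pi fun _ : Fin m => Measure.pi fun _ : Fin n => μ) with hP
  set ν := (Measure.count : Measure (Fin n)).prod μ with hν
  set T0 : Θ × (Fin m → Fin n → Ω) → ℝ≥0∞ := fun w => ∫⁻ y : Fin n → Ω,
      (∑ j, KK lam g (w.1, (j, y j), w.2)) ^ q ∂(Measure.pi fun _ : Fin n => μ) with hT0
  have hT0m : Measurable T0 := Measurable.lintegral_prod_right'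
    (f := fun w : (Θ × (Fin m → Fin n → Ω)) × (Fin n → Ω) =>
      (∑ j, KK lam g (w.1.1, (j, w.2 j), w.1.2)) ^ q) (by fun_prop)
  have hU : UU q μ n (m + 1) θ lam g = ∫⁻ ϑ, ∫⁻ x, T0 (ϑ, x) ∂P ∂θ := UU_succ θ lam μ hg
  set B : Set (Θ × (Fin n × Ω) × (Fin m → Fin n → Ω)) :=
    {w | thr 1 q (T0 (w.1, w.2.2)) < KK lam g w} with hB
  have hBm : MeasurableSet B := by
    refine measurableSet_lt ?_ hK
    unfold thr
    fun_prop
  have hBi : Measurable (B.indicator (1 : Θ × (Fin n × Ω) × (Fin m → Fin n → Ω) → ℝ≥0∞)) :=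
    measurable_one.indicator hBm
  have hBci : Measurable (Bᶜ.indicator (1 : Θ × (Fin n × Ω) × (Fin m → Fin n → Ω) → ℝ≥0∞)) :=
    measurable_one.indicator hBm.compl
  -- the pointwise estimate
  have hkey : ∀ ϑ x, (∑ j, ∫⁻ t, (KK lam g (ϑ, (j, t), x) * B.indicator 1 (ϑ, (j, t), x)) ^ q ∂μ
        ≤ 80 * T0 (ϑ, x)) ∧
      ((∑ j, ∫⁻ t, KK lam g (ϑ, (j, t), x) * Bᶜ.indicator 1 (ϑ, (j, t), x) ∂μ) ^ q
        ≤ 80 * T0 (ϑ, x)) := by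
    intro ϑ x
    have := key μ (G := fun j t => KK lam g (ϑ, (j, t), x))
      (H := fun j (y : Fin n → Ω) => KK lam g (ϑ, (j, y j), x)) (by intro j; fun_prop) (by intro j; fun_prop)
      (fun _ _ => le_rfl) hq0 hq1 (k := 1) le_rfl (by simp) (by intro j t R hR; simp)
      (T := T0 (ϑ, x)) rfl
    simp only [one_pow, mul_one] at this
    refine ⟨le_of_eq_of_le ?_ this.1, le_of_eq_of_le ?_ this.2⟩
    · refine Finset.sum_congr rfl fun j _ => lintegral_congr fun t => ?_
      by_cases h : thr 1 q (T0 (ϑ, x)) < KK lam g (ϑ, (j, t), x)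
      · have h' : (ϑ, (j, t), x) ∈ B := h
        simp [h, h']
      · have h' : (ϑ, (j, t), x) ∉ B := h
        simp [h, h', hq0]
    · congr 1
      refine Finset.sum_congr rfl fun j _ => lintegral_congr fun t => ?_
      by_cases h : thr 1 q (T0 (ϑ, x)) < KK lam g (ϑ, (j, t), x)
      · have h' : (ϑ, (j, t), x) ∈ B := h
        simp [h, h']
      · have h' : (ϑ, (j, t), x) ∉ B := h
        simp [h, h']
  -- the set A
  set φ : Θ × (Fin n × Ω) × (Fin m → Fin n × Ω) → ℝ≥0∞ := fun w => ∫⁻ x,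
    B.indicator 1 (w.1, w.2.1, fun a => Function.update (x a) (w.2.2 a).1 (w.2.2 a).2) ∂P with hφ
  have hupd : Measurable (fun w : (Θ × (Fin n × Ω) × (Fin m → Fin n × Ω)) × (Fin m → Fin n → Ω) =>
      (w.1.1, w.1.2.1, fun a => Function.update (w.2 a) (w.1.2.2 a).1 (w.1.2.2 a).2)) := by
    refine Measurable.prodMk (by fun_prop) (Measurable.prodMk (by fun_prop) ?_)
    exact measurable_pi_iff.2 fun a => measurable_update'' (by fun_prop) (by fun_prop) (by fun_prop)
  have hφm : Measurable φ := Measurable.lintegral_prod_right'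
    (f := fun w : (Θ × (Fin n × Ω) × (Fin m → Fin n × Ω)) × (Fin m → Fin n → Ω) =>
      B.indicator 1 (w.1.1, w.1.2.1, fun a => Function.update (w.2 a) (w.1.2.2 a).1 (w.1.2.2 a).2))
    (hBi.comp hupd)
  set A : Set (Θ × (Fin n × Ω) × (Fin m → Fin n × Ω)) := {w | 1 ≤ 2 * φ w} with hA
  have hAm : MeasurableSet A := measurableSet_le measurable_const (by fun_prop)
  have hAi : Measurable (A.indicator (1 : Θ × (Fin n × Ω) × (Fin m → Fin n × Ω) → ℝ≥0∞)) :=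
    measurable_one.indicator hAm
  have hAci : Measurable (Aᶜ.indicator (1 : Θ × (Fin n × Ω) × (Fin m → Fin n × Ω) → ℝ≥0∞)) :=
    measurable_one.indicator hAm.compl
  have hAc : ∀ w ∉ A, 1 ≤ 2 * ∫⁻ x,
      Bᶜ.indicator 1 (w.1, w.2.1, fun a => Function.update (x a) (w.2.2 a).1 (w.2.2 a).2) ∂P := by
    intro w hw
    exact compl_half P hBm (hupd.comp (by fun_prop : Measurable fun x => (w, x))) hw
  have hi1 : ∀ {α : Type u} (S : Set α) (w : α), S.indicator (1 : α → ℝ≥0∞) w ≤ 1 :=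
    fun S w => Set.indicator_le_self' (fun _ _ => zero_le) w
  refine ⟨A, hAm, ?_, ?_⟩
  · rw [hU]
    have h1 : ∀ w : Θ × Fin n × Ω, ∫⁻ x : Fin m → Fin n → Ω, (∫⁻ l, ∑ i : Fin m → Fin n,
        (g (w.1, l, Fin.cons w.2 (fun k => (i k, x k (i k)))) *
          A.indicator 1 (w.1, w.2, fun k => (i k, x k (i k)))) ∂lam) ^ q ∂P ≤
        CL m 2 * ∫⁻ x, (KK lam g (w.1, w.2, x) * B.indicator 1 (w.1, w.2, x)) ^ q ∂P := by
      intro w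
      refine (Lm_sum μ hq0 hq1 lam (k := 2) (by norm_num) (by simp)
        (h := fun v => g (w.1, v.1, Fin.cons w.2 v.2) * A.indicator 1 (w.1, w.2, v.2))
        ?_ ?_ (b := fun v => B.indicator 1 (w.1, w.2, v.2)) ?_ ?_ ?_).trans ?_
      · exact Measurable.mul (by fun_prop) (hAi.comp (by fun_prop))
      · exact fun v => ENNReal.mul_ne_top (hgt _) (ne_top_of_le_ne_top ENNReal.one_ne_top (hi1 _ _))
      · exact hBi.comp (by fun_prop)
      · exact fun v => hi1 _ _
      · intro l z hl
        by_contra h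
        have : (w.1, w.2, z) ∉ A := h
        simp [this] at hl
      · refine mul_le_mul_right (lintegral_mono fun x => ENNReal.rpow_le_rpow ?_ hq0.le) _
        unfold KK
        rw [← lintegral_mul_const' _ _ (ne_top_of_le_ne_top ENNReal.one_ne_top (hi1 _ _))]
        refine lintegral_mono fun l => ?_
        refine mul_le_mul_left (Finset.sum_le_sum fun i _ => ?_) _
        exact mul_le_of_le_one_right zero_le (hi1 _ _)
    calc _ ≤ ∫⁻ w : Θ × Fin n × Ω, CL m 2 * ∫⁻ x, (KK lam g (w.1, w.2, x) *
          B.indicator 1 (w.1, w.2, x)) ^ q ∂P ∂(θ.prod ν) := lintegral_mono h1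
      _ = CL m 2 * ∫⁻ ϑ, ∫⁻ x, ∑ j, ∫⁻ t, (KK lam g (ϑ, (j, t), x) *
          B.indicator 1 (ϑ, (j, t), x)) ^ q ∂μ ∂P ∂θ := by
          rw [lintegral_const_mul' _ _ hCL]
          congr 1
          exact fub μ θ P (F := fun w => (KK lam g w * B.indicator 1 w) ^ q) (by fun_prop)
      _ ≤ CL m 2 * ∫⁻ ϑ, ∫⁻ x, 80 * T0 (ϑ, x) ∂P ∂θ :=
          mul_le_mul_right (lintegral_mono fun ϑ => lintegral_mono fun x => (hkey ϑ x).1) _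
      _ = _ := by
          have h80 : (80 : ℝ≥0∞) ≠ ∞ := by finiteness
          simp only [lintegral_const_mul' _ _ h80, mul_assoc]
  · rw [hU]
    have hKB : ∀ ϑ x, ∫⁻ l : Λ × Fin n × Ω, (∑ i : Fin m → Fin n,
        g (ϑ, l.1, Fin.cons l.2 (fun k => (i k, x k (i k))))) * Bᶜ.indicator 1 (ϑ, l.2, x)
          ∂(lam.prod ν) =
        ∑ j, ∫⁻ t, KK lam g (ϑ, (j, t), x) * Bᶜ.indicator 1 (ϑ, (j, t), x) ∂μ := by
      intro ϑ x
      have hm1 : Measurable (fun l : Λ × Fin n × Ω => (∑ i : Fin m → Fin n,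
        g (ϑ, l.1, Fin.cons l.2 (fun k => (i k, x k (i k))))) * Bᶜ.indicator 1 (ϑ, l.2, x)) :=
        Measurable.mul (by fun_prop) (hBci.comp (by fun_prop))
      rw [lintegral_prod _ hm1.aemeasurable, lintegral_lintegral_swap hm1.aemeasurable]
      have e : ∀ z, ∫⁻ l, (∑ i : Fin m → Fin n,
        g (ϑ, l, Fin.cons z (fun k => (i k, x k (i k))))) * Bᶜ.indicator 1 (ϑ, z, x) ∂lam =
          KK lam g (ϑ, z, x) * Bᶜ.indicator 1 (ϑ, z, x) := by
        intro z
        rw [lintegral_mul_const' _ _ (ne_top_of_le_ne_top ENNReal.one_ne_top (hi1 _ _))]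
        rfl
      simp only [e]
      exact lintegral_nu μ (F := fun z => KK lam g (ϑ, z, x) * Bᶜ.indicator 1 (ϑ, z, x))
        (Measurable.mul (by fun_prop) (hBci.comp (by fun_prop)))
    have h1 : ∀ ϑ : Θ, ∫⁻ x : Fin m → Fin n → Ω, (∫⁻ l : Λ × Fin n × Ω, ∑ i : Fin m → Fin n,
        (g (ϑ, l.1, Fin.cons l.2 (fun k => (i k, x k (i k)))) *
          Aᶜ.indicator 1 (ϑ, l.2, fun k => (i k, x k (i k)))) ∂(lam.prod ν)) ^ q ∂P ≤
        CL m 2 * ∫⁻ x, (∑ j, ∫⁻ t, KK lam g (ϑ, (j, t), x) *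
          Bᶜ.indicator 1 (ϑ, (j, t), x) ∂μ) ^ q ∂P := by
      intro ϑ
      refine (Lm_sum μ hq0 hq1 (lam.prod ν) (k := 2) (by norm_num) (by simp)
        (h := fun v => g (ϑ, v.1.1, Fin.cons v.1.2 v.2) * Aᶜ.indicator 1 (ϑ, v.1.2, v.2))
        ?_ ?_ (b := fun v => Bᶜ.indicator 1 (ϑ, v.1.2, v.2)) ?_ ?_ ?_).trans ?_
      · exact Measurable.mul (by fun_prop) (hAci.comp (by fun_prop))
      · exact fun v => ENNReal.mul_ne_top (hgt _) (ne_top_of_le_ne_top ENNReal.one_ne_top (hi1 _ _))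
      · exact hBci.comp (by fun_prop)
      · exact fun v => hi1 _ _
      · intro l z hl
        refine hAc (ϑ, l.2, z) fun h => ?_
        simp [h] at hl
      · refine mul_le_mul_right (lintegral_mono fun x => ENNReal.rpow_le_rpow ?_ hq0.le) _
        rw [← hKB]
        refine lintegral_mono fun l => ?_
        refine mul_le_mul_left (Finset.sum_le_sum fun i _ => ?_) _
        exact mul_le_of_le_one_right zero_le (hi1 _ _)
    calc _ ≤ ∫⁻ ϑ, CL m 2 * ∫⁻ x, (∑ j, ∫⁻ t, KK lam g (ϑ, (j, t), x) *
          Bᶜ.indicator 1 (ϑ, (j, t), x) ∂μ) ^ q ∂P ∂θ := lintegral_mono h1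
      _ = CL m 2 * ∫⁻ ϑ, ∫⁻ x, (∑ j, ∫⁻ t, KK lam g (ϑ, (j, t), x) *
          Bᶜ.indicator 1 (ϑ, (j, t), x) ∂μ) ^ q ∂P ∂θ := lintegral_const_mul' _ _ hCL
      _ ≤ CL m 2 * ∫⁻ ϑ, ∫⁻ x, 80 * T0 (ϑ, x) ∂P ∂θ :=
          mul_le_mul_right (lintegral_mono fun ϑ => lintegral_mono fun x => (hkey ϑ x).2) _
      _ = _ := by
          have h80 : (80 : ℝ≥0∞) ≠ ∞ := by finiteness
          simp only [lintegral_const_mul' _ _ h80, mul_assoc]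

/-- The constants of the decomposition. -/
noncomputable def CT : ℕ → ℝ≥0∞
  | 0 => 1
  | m + 1 => CT m * (CL m 2 * 80) + CT m * (CL m 2 * 80)

theorem CT_ne_top (m : ℕ) : CT m ≠ ∞ := by
  induction m with
  | zero => simp [CT]
  | succ m ih =>
    have := CL_ne_top m 2 (by simp)
    rw [CT]
    finiteness

theorem sum_cons_bool {m : ℕ} (F : (Fin (m+1) → Bool) → ℝ≥0∞) :
    ∑ J, F J = ∑ J', F (Fin.cons false J') + ∑ J', F (Fin.cons true J') := by
  rw [← (Fin.consEquiv (fun _ : Fin (m+1) => Bool)).sum_comp, Fintype.sum_prod_type]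
  rw [Fintype.sum_bool, add_comm]
  rfl

theorem upper {Ω : Type u} [MeasurableSpace Ω] {n : ℕ} (μ : Measure Ω)
    [IsProbabilityMeasure μ] {q : ℝ} (hq0 : 0 < q) (hq1 : q ≤ 1) (m : ℕ) :
    ∀ {Θ Λ : Type u} [MeasurableSpace Θ] [MeasurableSpace Λ]
    (θ : Measure Θ) (lam : Measure Λ) [SigmaFinite θ] [SigmaFinite lam]
    {g : Θ × Λ × (Fin m → Fin n × Ω) → ℝ≥0∞} (_ : Measurable g) (_ : ∀ w, g w ≠ ∞),
    ∃ s : Θ × (Fin m → Fin n × Ω) → (Fin m → Bool), Measurable s ∧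
      ∑ J, MN q ((Measure.count : Measure (Fin n)).prod μ) m J θ lam
        (fun w => if s (w.1, w.2.2) = J then g w else 0) ≤ CT m * UU q μ n m θ lam g := by
  induction m with
  | zero =>
    intro Θ Λ _ _ θ lam _ _ g hg hgt
    refine ⟨fun _ => Fin.elim0, measurable_const, ?_⟩
    have : ∀ f : Fin 0 → Fin n × Ω, f = Fin.elim0 := fun f => Subsingleton.elim _ _
    have h2 : ∀ f f' : Fin 0 → Bool, (f = f') = True := fun f f' =>
      eq_true (Subsingleton.elim _ _)
    simp [MN, UU, CT, this, h2]
  | succ m ih =>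
    intro Θ Λ _ _ θ lam _ _ g hg hgt
    obtain ⟨A, hAm, h1, h2⟩ := upper_step μ hq0 hq1 θ lam hg hgt
    have hAi : Measurable (A.indicator (1 : Θ × (Fin n × Ω) × (Fin m → Fin n × Ω) → ℝ≥0∞)) :=
      measurable_one.indicator hAm
    have hAci : Measurable (Aᶜ.indicator (1 : Θ × (Fin n × Ω) × (Fin m → Fin n × Ω) → ℝ≥0∞)) :=
      measurable_one.indicator hAm.compl
    have hi1 : ∀ {α : Type u} (S : Set α) (w : α), S.indicator (1 : α → ℝ≥0∞) w ≤ 1 :=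
      fun S w => Set.indicator_le_self' (fun _ _ => zero_le) w
    obtain ⟨sa, hsa, ha⟩ := ih (θ.prod ((Measure.count : Measure (Fin n)).prod μ)) lam
      (g := fun w => g (w.1.1, w.2.1, Fin.cons w.1.2 w.2.2) * A.indicator 1 (w.1.1, w.1.2, w.2.2))
      (Measurable.mul (by fun_prop) (hAi.comp (by fun_prop)))
      (fun v => ENNReal.mul_ne_top (hgt _) (ne_top_of_le_ne_top ENNReal.one_ne_top (hi1 _ _)))
    obtain ⟨sb, hsb, hb⟩ := ih θ (lam.prod ((Measure.count : Measure (Fin n)).prod μ))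
      (g := fun w => g (w.1, w.2.1.1, Fin.cons w.2.1.2 w.2.2) *
        Aᶜ.indicator 1 (w.1, w.2.1.2, w.2.2))
      (Measurable.mul (by fun_prop) (hAci.comp (by fun_prop)))
      (fun v => ENNReal.mul_ne_top (hgt _) (ne_top_of_le_ne_top ENNReal.one_ne_top (hi1 _ _)))
    classical
    have htail : Measurable (fun w : Θ × (Fin (m+1) → Fin n × Ω) => (Fin.tail w.2)) := by
      unfold Fin.tail; fun_prop
    refine ⟨fun w => if (w.1, w.2 0, Fin.tail w.2) ∈ A then
      Fin.cons false (sa ((w.1, w.2 0), Fin.tail w.2)) else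
      Fin.cons true (sb (w.1, Fin.tail w.2)), ?_, ?_⟩
    · refine Measurable.ite ?_ ?_ ?_
      · exact hAm.preimage (by fun_prop :
          Measurable fun w : Θ × (Fin (m+1) → Fin n × Ω) => (w.1, w.2 0, Fin.tail w.2))
      · fun_prop
      · fun_prop
    · rw [sum_cons_bool, CT, add_mul]
      refine add_le_add ?_ ?_
      · rw [mul_assoc]
        refine le_trans (le_of_eq ?_) (ha.trans (mul_le_mul_right h1 _))
        refine Finset.sum_congr rfl fun J _ => ?_
        rw [MN, if_neg (by simp)]
        simp only [Fin.cons_succ, Fin.cons_zero, Fin.tail_cons]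
        congr 1
        funext w
        by_cases h : (w.1.1, w.1.2, w.2.2) ∈ A
        · simp [h]
        · simp only [h, if_false]
          rw [if_neg]
          · simp [h]
          · intro h'; simpa using congrFun h' 0
      · rw [mul_assoc]
        refine le_trans (le_of_eq ?_) (hb.trans (mul_le_mul_right h2 _))
        refine Finset.sum_congr rfl fun J _ => ?_
        rw [MN, if_pos (by simp)]
        simp only [Fin.cons_succ, Fin.cons_zero, Fin.tail_cons]
        congr 1
        funext w
        by_cases h : (w.1, w.2.1.2, w.2.2) ∈ A
        · simp only [h, if_true]
          rw [if_neg]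
          · simp [h]
          · intro h'; simpa using congrFun h' 0
        · simp [h]

theorem minkowski_sum {ι κ : Type*} [Fintype ι] (S : Finset κ) (v : κ → ι → ℝ≥0∞) {p : ℝ}
    (hp : 1 ≤ p) : (∑ i, (∑ J ∈ S, v J i) ^ p) ^ (1 / p) ≤ ∑ J ∈ S, (∑ i, v J i ^ p) ^ (1 / p) := by
  classical
  have hp0 : 0 < p := by linarith
  induction S using Finset.induction_on with
  | empty => simp [hp0]
  | insert a S ha ih =>
    simp only [Finset.sum_insert ha]
    exact (ENNReal.Lp_add_le _ _ _ hp).trans (by gcongr)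

/-- Subsets as boolean functions. -/
def finsetBool (m : ℕ) : Finset (Fin m) ≃ (Fin m → Bool) where
  toFun J k := decide (k ∈ J)
  invFun b := Finset.univ.filter fun k => b k = true
  left_inv J := by ext; simp
  right_inv b := by funext k; simp

theorem UU_gof {Ω : Type u} [MeasurableSpace Ω] (μ : Measure Ω) [IsProbabilityMeasure μ] {n m : ℕ}
    (p : ℝ) (f : (Fin m → Fin n) → (Fin m → Ω) → ℝ) :
    UU (1/p) μ n m (Measure.dirac PUnit.unit) (Measure.dirac PUnit.unit) (gof p f) =
      ∫⁻ x : Fin m → Fin n → Ω,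
            (∑ i : Fin m → Fin n, ENNReal.ofReal (|f i fun k => x k (i k)| ^ p)) ^ (1/p)
            ∂Measure.pi fun _ : Fin m => Measure.pi fun _ : Fin n => μ := by
  simp only [UU, lintegral_dirac]
  rfl

/-- **The `2^m`-summand decomposition theorem** (Theorem `2msummand` of the paper):
if `∫⋯∫ (∑_i |f i (x^{(1)}_{i 1}, …, x^{(m)}_{i m})|^p)^{1/p} = 1` then every decomposition
`⨿_i f_i = ∑_{J ⊆ [1,m]} a^{(J)}` has `∑_J ‖a^{(J)}‖_{L¹(Ω̄^{J'},L^p(Ω̄^J))} ≥ 1`, and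
there exists such a decomposition with `∑_J ‖a^{(J)}‖ ≤ C_m`, where `C_m` depends only on
`m`, whose pieces `a^{(J)}_i` have pairwise disjoint supports over `J`. -/
theorem two_pow_m_summand_decomposition (m : ℕ) (hm : 1 ≤ m) :
    ∃ C : ℝ, 0 < C ∧
      ∀ (Ω : Type u) [MeasurableSpace Ω] (μ : Measure Ω) [IsProbabilityMeasure μ]
        (n : ℕ) (p : ℝ), 1 ≤ p →
      ∀ f : (Fin m → Fin n) → (Fin m → Ω) → ℝ,
        (∀ i, Measurable (f i)) →
        (∫⁻ x : Fin m → Fin n → Ω,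
            (∑ i : Fin m → Fin n, ENNReal.ofReal (|f i fun k => x k (i k)| ^ p)) ^ (1/p)
            ∂Measure.pi fun _ : Fin m => Measure.pi fun _ : Fin n => μ) = 1 →
        (∀ a : Finset (Fin m) → (Fin m → Fin n) → (Fin m → Ω) → ℝ,
            (∀ J i, Measurable (a J i)) →
            (∀ i ξ, f i ξ = ∑ J : Finset (Fin m), a J i ξ) →
            1 ≤ ∑ J : Finset (Fin m), mixedNorm μ p J (a J)) ∧
        ∃ a : Finset (Fin m) → (Fin m → Fin n) → (Fin m → Ω) → ℝ,
          (∀ J i, Measurable (a J i)) ∧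
          (∀ i ξ, f i ξ = ∑ J : Finset (Fin m), a J i ξ) ∧
          (∀ i ξ J J', J ≠ J' → a J i ξ = 0 ∨ a J' i ξ = 0) ∧
          ∑ J : Finset (Fin m), mixedNorm μ p J (a J) ≤ ENNReal.ofReal C := by
  refine ⟨(CT m).toReal + 1, by positivity, ?_⟩
  intro Ω _ μ _ n p hp f hf hint
  have hp0 : 0 < p := by linarith
  have hq0 : 0 < 1 / p := by positivity
  have hq1 : 1 / p ≤ 1 := by rw [div_le_one hp0]; exact hp
  have hn : 0 < n := by
    rcases Nat.eq_zero_or_pos n with rfl | h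
    · exfalso
      have : Nonempty (Fin m) := ⟨⟨0, hm⟩⟩
      simp [hp0] at hint
    · exact h
  have hΩ : Nonempty Ω := nonempty_of_isProbabilityMeasure μ
  obtain ⟨ω⟩ := hΩ
  set z0 : Fin m → Fin n × Ω := fun _ => (⟨0, hn⟩, ω) with hz0
  constructor
  · intro a ha hfa
    rw [← hint]
    calc _ ≤ ∫⁻ x : Fin m → Fin n → Ω, ∑ J : Finset (Fin m),
            (∑ i : Fin m → Fin n, ENNReal.ofReal (|a J i fun k => x k (i k)| ^ p)) ^ (1/p)
            ∂Measure.pi fun _ : Fin m => Measure.pi fun _ : Fin n => μ := by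
          refine lintegral_mono fun x => ?_
          refine le_trans ?_ (le_trans (minkowski_sum Finset.univ (fun (J : Finset (Fin m)) i =>
            ENNReal.ofReal |a J i fun k => x k (i k)|) hp) ?_)
          · refine ENNReal.rpow_le_rpow (Finset.sum_le_sum fun i _ => ?_) hq0.le
            rw [← ENNReal.ofReal_rpow_of_nonneg (abs_nonneg _) hp0.le]
            refine ENNReal.rpow_le_rpow ?_ hp0.le
            rw [← ENNReal.ofReal_sum_of_nonneg (fun _ _ => abs_nonneg _), hfa]
            exact ENNReal.ofReal_le_ofReal (Finset.abs_sum_le_sum_abs _ _)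
          · simp only [ENNReal.ofReal_rpow_of_nonneg (abs_nonneg _) hp0.le]
            exact le_rfl
      _ = ∑ J : Finset (Fin m), ∫⁻ x : Fin m → Fin n → Ω,
            (∑ i : Fin m → Fin n, ENNReal.ofReal (|a J i fun k => x k (i k)| ^ p)) ^ (1/p)
            ∂Measure.pi fun _ : Fin m => Measure.pi fun _ : Fin n => μ := by
          rw [lintegral_finsetSum]
          intro J _
          refine Measurable.pow_const (Finset.measurable_sum _ fun i _ => ?_) _
          refine ENNReal.measurable_ofReal.comp (Measurable.pow_const ?_ p)
          exact ((ha J i).comp (by fun_prop)).abs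
      _ ≤ _ := by
          refine Finset.sum_le_sum fun J _ => ?_
          rw [← UU_gof, mixedNorm_eq μ p J (ha J) z0]
          exact UU_le_MN μ hq0 hq1 m _ _ _ (measurable_gof (ha J))
  · obtain ⟨s, hs, hle⟩ := upper μ hq0 hq1 m (Measure.dirac PUnit.unit) (Measure.dirac PUnit.unit)
      (measurable_gof (p := p) hf) (fun w => ENNReal.ofReal_ne_top)
    rw [UU_gof, hint, mul_one] at hle
    have ham : ∀ (J : Finset (Fin m)) i, Measurable (fun ξ : Fin m → Ω =>
        if s (PUnit.unit, fun k => (i k, ξ k)) = (fun k => decide (k ∈ J)) then f i ξ else 0) := by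
      intro J i
      refine Measurable.ite ?_ (hf i) measurable_const
      exact (hs.comp (by fun_prop : Measurable fun ξ : Fin m → Ω =>
        ((PUnit.unit : PUnit.{u+1}), fun k => (i k, ξ k)))) (measurableSet_singleton _)
    refine ⟨fun J i ξ => if s (PUnit.unit, fun k => (i k, ξ k)) = (fun k => decide (k ∈ J))
      then f i ξ else 0, ham, ?_, ?_, ?_⟩
    · intro i ξ
      rw [Finset.sum_eq_single ((finsetBool m).symm (s (PUnit.unit, fun k => (i k, ξ k))))]
      · dsimp only
        rw [if_pos]
        exact ((finsetBool m).apply_symm_apply _).symm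
      · intro J _ hJ
        dsimp only
        rw [if_neg]
        intro h
        apply hJ
        rw [h]
        exact ((finsetBool m).symm_apply_apply J).symm
      · simp
    · intro i ξ J J' hJ
      dsimp only
      by_cases h : s (PUnit.unit, fun k => (i k, ξ k)) = (fun k => decide (k ∈ J))
      · right
        rw [if_neg]
        intro h'
        exact hJ ((finsetBool m).injective (h.symm.trans h'))
      · left
        rw [if_neg h]
    · calc _ = ∑ J : Finset (Fin m), MN (1/p) ((Measure.count : Measure (Fin n)).prod μ) m
              (finsetBool m J) (Measure.dirac PUnit.unit) (Measure.dirac PUnit.unit)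
              (fun w => if s (w.1, w.2.2) = finsetBool m J then gof p f w else 0) := by
            refine Finset.sum_congr rfl fun J _ => ?_
            rw [mixedNorm_eq μ p J (ham J) z0]
            have e : (gof p fun i ξ => if s (PUnit.unit, fun k => (i k, ξ k)) =
                (fun k => decide (k ∈ J)) then f i ξ else 0) =
                (fun w => if s (w.1, w.2.2) = finsetBool m J then gof p f w else 0) := by
              funext w
              have h1 : finsetBool m J = fun k => decide (k ∈ J) := rfl
              rw [h1]
              unfold gof
              by_cases h : s (PUnit.unit, w.2.2) = (fun k => decide (k ∈ J))
              · simp [h]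
              · simp [h, hp0.ne']
            rw [e]
            rfl
        _ = ∑ J, MN (1/p) ((Measure.count : Measure (Fin n)).prod μ) m
              J (Measure.dirac PUnit.unit) (Measure.dirac PUnit.unit)
              (fun w => if s (w.1, w.2.2) = J then gof p f w else 0) :=
            (finsetBool m).sum_comp (fun J => MN (1/p) ((Measure.count : Measure (Fin n)).prod μ) m
              J (Measure.dirac PUnit.unit) (Measure.dirac PUnit.unit)
              (fun w => if s (w.1, w.2.2) = J then gof p f w else 0))
        _ ≤ CT m := hle
        _ ≤ _ := by
            rw [← ENNReal.ofReal_toReal (CT_ne_top m)]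
            exact ENNReal.ofReal_le_ofReal (by simp)
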